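/- arXiv:1707.02542 — 3 statements merged into one kernel-verified Lean document; each statement's English description precedes it below -/
import Mathlib

section
/- Let R be a 1-dimensional noetherian local ring with maximal ideal m. (1) The Serre subcategory of m-cofinite R-modules satisfies MP[S_{m-cof}] = Spec(R). (2) For each minimal prime ideal p of R, the Serre subcategory of p-cofinite R-modules satisfies MP[S_{p-cof}] = {p}. -/
/-!
Common framework: a *Serre class* is a class of (bundled) `R`-modules closed under
submodules, quotient modules and extensions.  `MelkerssonCondition R P I` is the
Melkersson condition `(C_I)`: if `Γ_I(M) = M` (every element of `M` is annihilated by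
some power of `I`) and `(0 :_M I)` (the `I`-torsion-by-`I` submodule `torsionBySet`)
belongs to the class, then `M` belongs to the class.  `MP R P` is the set of prime
ideals `p` such that the class satisfies `(C_p)`.
-/

open CategoryTheory

structure SerreClass (R : Type) [CommRing R] where
  mem : ModuleCat.{0} R → Prop
  mem_of_injective : ∀ {M N : ModuleCat.{0} R} (f : M →ₗ[R] N),
    Function.Injective f → mem N → mem M
  mem_of_surjective : ∀ {M N : ModuleCat.{0} R} (f : M →ₗ[R] N),
    Function.Surjective f → mem M → mem N
  mem_of_extension : ∀ {A M B : ModuleCat.{0} R} (f : A →ₗ[R] M) (g : M →ₗ[R] B),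
    Function.Injective f → Function.Surjective g →
    LinearMap.range f = LinearMap.ker g → mem A → mem B → mem M

variable (R : Type) [CommRing R]

/-- `Γ_I(M) = M`: every element of `M` is annihilated by some power of `I`. -/
def IsTorsionByPowers (I : Ideal R) (M : ModuleCat.{0} R) : Prop :=
  ∀ m : M, ∃ n : ℕ, ∀ x ∈ I ^ n, x • m = 0

/-- The Melkersson condition `(C_I)` for a class `P` of `R`-modules:
if `Γ_I(M) = M` and `(0 :_M I) ∈ P` then `M ∈ P`. -/
def MelkerssonCondition (P : ModuleCat.{0} R → Prop) (I : Ideal R) : Prop :=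
  ∀ M : ModuleCat.{0} R, IsTorsionByPowers R I M →
    P (ModuleCat.of R (Submodule.torsionBySet R M (I : Set R))) → P M

/-- `MP[P]`: the set of prime ideals `p` such that `P` satisfies `(C_p)`. -/
def MP (P : ModuleCat.{0} R → Prop) : Set (PrimeSpectrum R) :=
  { p | MelkerssonCondition R P p.asIdeal }

/-- The class `FG` of finitely generated `R`-modules. -/
def FGClass : ModuleCat.{0} R → Prop := fun M => Module.Finite R M

/-- Membership in the extension subcategory `P * Q`: `M` fits in a short exact
sequence `0 → A → M → B → 0` with `A ∈ P` and `B ∈ Q`. -/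
def IsExtensionIn (P Q : ModuleCat.{0} R → Prop) (M : ModuleCat.{0} R) : Prop :=
  ∃ (A B : ModuleCat.{0} R) (f : A →ₗ[R] M) (g : M →ₗ[R] B),
    Function.Injective f ∧ Function.Surjective g ∧
    LinearMap.range f = LinearMap.ker g ∧ P A ∧ Q B

/-- `Supp(P) = ⋃_{M ∈ P} Supp_R M`. -/
def SuppClass (P : ModuleCat.{0} R → Prop) : Set (PrimeSpectrum R) :=
  ⋃ (M : ModuleCat.{0} R) (_ : P M), Module.support R M

/-- `E` is an injective hull of `N`: `E` is injective and contains `N` as an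
essential submodule. -/
def IsInjectiveHull (N E : ModuleCat.{0} R) : Prop :=
  Module.Injective R E ∧ ∃ f : N →ₗ[R] E, Function.Injective f ∧
    ∀ W : Submodule R E, W ≠ ⊥ → W ⊓ LinearMap.range f ≠ ⊥

/-- `M` is `I`-cofinite: `Supp M ⊆ V(I)` and `Ext^i_R(R/I, M)` is a finitely
generated `R`-module for every `i`. -/
noncomputable def IsCofiniteWrt (I : Ideal R) (M : ModuleCat.{0} R) : Prop :=
  Module.support R M ⊆ PrimeSpectrum.zeroLocus (I : Set R) ∧
  ∀ i : ℕ, Module.Finite R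
    (((Ext R (ModuleCat.{0} R) i).obj (Opposite.op (ModuleCat.of R (R ⧸ I)))).obj M)

/-- A specialization closed subset of `Spec R`. -/
def SpecializationClosed (W : Set (PrimeSpectrum R)) : Prop :=
  ∀ p ∈ W, ∀ q : PrimeSpectrum R, p.asIdeal ≤ q.asIdeal → q ∈ W

set_option linter.unusedSectionVars false


/-- f.g. by (artinian and killed by `s`) -/
def DC17 (R : Type) [CommRing R] (s : R) (M : Type) [AddCommGroup M] [Module R M] : Prop :=
  ∃ N : Submodule R M, N.FG ∧ IsArtinian R (M ⧸ N) ∧ ∀ m : M, s • m ∈ N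

section A
variable {R : Type} [CommRing R] [IsNoetherianRing R] {s x : R}
variable {M M' : Type} [AddCommGroup M] [Module R M] [AddCommGroup M'] [Module R M']

theorem DC17.of_injective (f : M' →ₗ[R] M) (hf : Function.Injective f) (h : DC17 R s M) :
    DC17 R s M' := by
  obtain ⟨N, hN, hA, hs⟩ := h
  refine ⟨N.comap f, ?_, ?_, ?_⟩
  · have : IsNoetherian R N := isNoetherian_of_fg_of_noetherian _ hN
    have : IsNoetherian R (N.comap f) := by
      refine isNoetherian_of_injective (f.restrict (p := N.comap f) (q := N) (fun x hx => hx)) ?_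
      intro a b hab
      apply Subtype.ext
      apply hf
      exact congrArg Subtype.val hab
    exact (Submodule.fg_top _).1 (Module.Finite.fg_top)
  · refine isArtinian_of_injective ((N.comap f).mapQ N f le_rfl) ?_
    rw [← LinearMap.ker_eq_bot, Submodule.ker_mapQ]
    simp
  · intro m
    simpa using hs (f m)

theorem DC17.of_surjective (f : M →ₗ[R] M') (hf : Function.Surjective f) (h : DC17 R s M) :
    DC17 R s M' := by
  obtain ⟨N, hN, hA, hs⟩ := h
  refine ⟨N.map f, hN.map f, ?_, ?_⟩
  · refine isArtinian_of_surjective _ (N.mapQ (N.map f) f (Submodule.le_comap_map _ _)) ?_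
    rw [← LinearMap.range_eq_top, Submodule.range_mapQ, LinearMap.range_eq_top.2 hf]
    simp
  · intro m
    obtain ⟨m, rfl⟩ := hf m
    exact ⟨s • m, hs m, by simp⟩

theorem DC17.pi (k : ℕ) (h : DC17 R s M) : DC17 R s (Fin k → M) := by
  obtain ⟨N, hN, hA, hs⟩ := h
  refine ⟨Submodule.pi Set.univ (fun _ => N), Submodule.fg_pi (fun _ => hN), ?_, ?_⟩
  · exact isArtinian_of_linearEquiv (Submodule.quotientPi (fun _ : Fin k => N)).symm
  · intro m
    simpa using fun i => hs (m i)

/-- A module over a ring with artinian quotient, killed by the ideal: noetherian iff artinian. -/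
theorem noeth_iff_art17 (J : Ideal R) [IsArtinianRing (R ⧸ J)]
    (hJ : Module.IsTorsionBySet R M (J : Set R)) : IsNoetherian R M ↔ IsArtinian R M := by
  let _ : Module (R ⧸ J) M := hJ.module
  have : IsScalarTower R (R ⧸ J) M := hJ.isScalarTower
  have h1 : IsNoetherian (R ⧸ J) M ↔ IsArtinian (R ⧸ J) M :=
    IsSemiprimaryRing.isNoetherian_iff_isArtinian
  have hs : Function.Surjective (algebraMap R (R ⧸ J)) := Ideal.Quotient.mk_surjective
  constructor
  · intro h
    have := h1.1 (isNoetherian_of_tower R h)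
    exact isArtinian_of_surjective_algebraMap hs
  · intro h
    have := h1.2 (isArtinian_of_tower R h)
    have : Module.Finite R M := Module.Finite.trans (R ⧸ J) M
    infer_instance

theorem torsionPair17 (h1 : ∀ m : M, x • m = 0) (h2 : ∀ m : M, s • m = 0) :
    Module.IsTorsionBySet R M (Ideal.span {x, s} : Set R) := by
  rw [← Module.isTorsionBySet_iff_is_torsion_by_span]
  rintro m ⟨a, rfl | rfl⟩
  · exact h1 m
  · exact h2 m

theorem DC17.finite (hart : IsArtinianRing (R ⧸ Ideal.span {x, s})) (h : DC17 R s M)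
    (hx : ∀ m : M, x • m = 0) : Module.Finite R M := by
  obtain ⟨N, hN, hA, hs⟩ := h
  have : IsNoetherian R (M ⧸ N) := by
    rw [noeth_iff_art17 (Ideal.span {x, s})]
    · exact hA
    · apply torsionPair17
      · rintro ⟨m⟩
        exact congrArg (Submodule.Quotient.mk (p := N)) (hx m)
      · rintro ⟨m⟩
        exact (Submodule.Quotient.mk_eq_zero N).2 (hs m)
  have : Module.Finite R N := Module.Finite.iff_fg.2 hN
  exact Module.Finite.of_submodule_quotient N

theorem DC17.of_finite [Module.Finite R M] : DC17 R s M := by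
  refine ⟨⊤, Module.Finite.fg_top, ?_, by simp⟩
  infer_instance

/-- Melkersson's lemma for a principal ideal. -/
theorem melk17 (ht : ∀ m : M, ∃ n : ℕ, x ^ n • m = 0)
    (h : IsArtinian R (Submodule.torsionBy R M x)) : IsArtinian R M := by
  let T := Submodule.torsionBy R M x
  let φ : ℕ → (M →ₗ[R] M) := fun n => LinearMap.lsmul R M (x ^ n)
  let L : ℕ → Submodule R M → Submodule R M := fun n N =>
    (N ⊓ LinearMap.ker (φ (n+1))).map (φ n)
  have memL : ∀ n N y, y ∈ L n N ↔ ∃ z ∈ N, x ^ (n+1) • z = 0 ∧ x ^ n • z = y := by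
    intro n N y
    simp [L, φ, Submodule.mem_map, and_assoc]
  have hLT : ∀ n N, L n N ≤ T := by
    intro n N y hy
    obtain ⟨z, hz, h0, rfl⟩ := (memL _ _ _).1 hy
    simp only [T, Submodule.mem_torsionBy_iff, smul_smul]
    rw [← pow_succ']; exact h0
  have hmono : ∀ n N N', N ≤ N' → L n N ≤ L n N' := by
    intro n N N' hN y hy
    obtain ⟨z, hz, h0, rfl⟩ := (memL _ _ _).1 hy
    exact (memL _ _ _).2 ⟨z, hN hz, h0, rfl⟩
  have hanti : ∀ N, Antitone (fun n => L n N) := by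
    intro N
    apply antitone_nat_of_succ_le
    intro n y hy
    obtain ⟨z, hz, h0, rfl⟩ := (memL _ _ _).1 hy
    refine (memL _ _ _).2 ⟨x • z, N.smul_mem _ hz, ?_, ?_⟩
    · rw [smul_smul, ← pow_succ]; exact h0
    · rw [smul_smul, ← pow_succ]
  have stab : ∀ (g : ℕ → Submodule R M), Antitone g → (∀ k, g k ≤ T) →
      ∃ K, ∀ k, K ≤ k → g K = g k := by
    intro g hg hgT
    obtain ⟨K, hK⟩ := monotone_stabilizes_iff_artinian.2 h
      ⟨fun k => OrderDual.toDual ((g k).comap T.subtype), fun a b hab =>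
        Submodule.comap_mono (hg hab)⟩
    refine ⟨K, fun k hk => ?_⟩
    have h1 : (g K).comap T.subtype = (g k).comap T.subtype := hK k hk
    have h2 := congrArg (Submodule.map T.subtype) h1
    rwa [Submodule.map_comap_subtype, Submodule.map_comap_subtype, inf_eq_right.2 (hgT _),
      inf_eq_right.2 (hgT _)] at h2
  rw [← monotone_stabilizes_iff_artinian]
  intro f
  let N : ℕ → Submodule R M := fun k => OrderDual.ofDual (f k)
  have hN : Antitone N := fun a b hab => f.monotone hab
  obtain ⟨K, hK⟩ := stab (fun k => L k (N k))
    (fun a b hab => (hanti _ hab).trans (hmono _ _ _ (hN hab))) (fun _ => hLT _ _)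
  have hst : ∀ n, ∃ J, ∀ k, J ≤ k → L n (N J) = L n (N k) := fun n =>
    stab (fun k => L n (N k)) (fun a b hab => hmono _ _ _ (hN hab)) (fun _ => hLT _ _)
  choose J hJ using hst
  let B := K + ∑ n ∈ Finset.range K, J n
  have hKB : K ≤ B := Nat.le_add_right _ _
  have key : ∀ k, B ≤ k → ∀ n, L n (N B) ≤ L n (N k) := by
    intro k hk n
    by_cases hn : n < K
    · have hJB : J n ≤ B := by
        have : J n ≤ ∑ n ∈ Finset.range K, J n :=
          Finset.single_le_sum (f := J) (fun _ _ => Nat.zero_le _) (Finset.mem_range.2 hn)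
        omega
      rw [← hJ n B hJB, ← hJ n k (hJB.trans hk)]
    · push Not at hn
      calc L n (N B) ≤ L K (N B) := hanti _ hn
        _ ≤ L K (N K) := hmono _ _ _ (hN hKB)
        _ = L (max n k) (N (max n k)) := hK _ (hn.trans (le_max_left _ _))
        _ ≤ L n (N (max n k)) := hanti _ (le_max_left _ _)
        _ ≤ L n (N k) := hmono _ _ _ (hN (le_max_right _ _))
  refine ⟨B, fun k hk => ?_⟩
  have : N B = N k := by
    apply le_antisymm _ (hN hk)
    have : ∀ n, ∀ z ∈ N B, x ^ n • z = 0 → z ∈ N k := by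
      intro n
      induction n with
      | zero => intro z _ hz; simp at hz; simp [hz]
      | succ n ih =>
        intro z hz h0
        obtain ⟨y, hy, hy0, hyz⟩ := (memL _ _ _).1 (key k hk n ((memL _ _ _).2 ⟨z, hz, h0, rfl⟩))
        have := ih (z - y) (sub_mem hz (hN hk hy)) (by rw [smul_sub, hyz, sub_self])
        simpa using add_mem this hy
    intro z hz
    obtain ⟨n, hn⟩ := ht z
    exact this n z hz hn
  exact this

/-- `0 :_M I^j` is f.g. -/
theorem fg_pow17 (I : Ideal R) (h : Module.Finite R (Submodule.torsionBySet R M (I : Set R)))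
    (j : ℕ) : Module.Finite R (Submodule.torsionBySet R M ((I ^ j : Ideal R) : Set R)) := by
  induction j with
  | zero =>
    have : Submodule.torsionBySet R M ((I ^ 0 : Ideal R) : Set R) = ⊥ := by
      rw [eq_bot_iff]
      intro m hm
      rw [Submodule.mem_torsionBySet_iff] at hm
      simpa using hm ⟨1, by simp⟩
    rw [this]; infer_instance
  | succ j ih =>
    obtain ⟨n, g, hg⟩ := Submodule.fg_iff_exists_fin_generating_family.1
      (IsNoetherian.noetherian I : I.FG)
    let f : Submodule.torsionBySet R M ((I ^ (j+1) : Ideal R) : Set R) →ₗ[R]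
        (Fin n → Submodule.torsionBySet R M ((I ^ j : Ideal R) : Set R)) :=
      LinearMap.pi fun i => LinearMap.restrict (LinearMap.lsmul R M (g i)) (by
        intro m hm
        rw [Submodule.mem_torsionBySet_iff] at hm ⊢
        rintro ⟨a, ha⟩
        have hgi : g i ∈ I := by rw [← hg]; exact Submodule.subset_span ⟨i, rfl⟩
        have := hm ⟨a * g i, by
          rw [pow_succ]; exact Ideal.mul_mem_mul ha hgi⟩
        simpa [smul_smul] using this)
    have hk : ∀ m ∈ LinearMap.ker f, (m : M) ∈ Submodule.torsionBySet R M (I : Set R) := by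
      intro m hm
      have e : (I : Set R) = ((Ideal.span (Set.range g) : Ideal R) : Set R) :=
        congrArg _ hg.symm
      rw [e, ← Submodule.torsionBySet_eq_torsionBySet_span, Submodule.mem_torsionBySet_iff]
      rintro ⟨_, ⟨i, rfl⟩⟩
      have := congrFun (LinearMap.mem_ker.1 hm) i
      exact congrArg Subtype.val this
    have : IsNoetherian R (Submodule.torsionBySet R M (I : Set R)) := inferInstance
    have hker : IsNoetherian R (LinearMap.ker f) := by
      refine isNoetherian_of_injective (((Submodule.subtype _).comp (LinearMap.ker f).subtype).codRestrict
        (Submodule.torsionBySet R M (I : Set R)) (fun m => hk m m.2)) ?_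
      intro a b hab
      exact Subtype.ext (Subtype.ext
        (congrArg (fun t : Submodule.torsionBySet R M (I : Set R) => (t : M)) hab))
    have := isNoetherian_of_range_eq_ker (LinearMap.ker f).subtype f.rangeRestrict (by simp)
    infer_instance

/-- main structural lemma -/
theorem DC17.of_torsion (I : Ideal R) (hxI : x ∈ I) (k N : ℕ) (hk : I ^ k ≤ Ideal.span {x})
    (hs : s * x ^ N = 0) (hart : IsArtinianRing (R ⧸ Ideal.span {x, s}))
    (ht : ∀ m : M, ∃ n : ℕ, ∀ a ∈ I ^ n, a • m = 0)
    (h : Module.Finite R (Submodule.torsionBySet R M (I : Set R))) : DC17 R s M := by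
  have hfg : ∀ n, Module.Finite R (Submodule.torsionBy R M (x ^ n)) := by
    intro n
    have := fg_pow17 I h (k * n)
    refine Module.Finite.of_injective (Submodule.inclusion
      (p := Submodule.torsionBy R M (x ^ n))
      (p' := Submodule.torsionBySet R M ((I ^ (k * n) : Ideal R) : Set R)) ?_)
      (Submodule.inclusion_injective _)
    intro m hm
    rw [Submodule.mem_torsionBy_iff] at hm
    rw [Submodule.mem_torsionBySet_iff]
    rintro ⟨a, ha⟩
    have : a ∈ Ideal.span {x ^ n} := by
      rw [← Ideal.span_singleton_pow]
      rw [SetLike.mem_coe, pow_mul] at ha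
      exact Ideal.pow_right_mono hk n ha
    obtain ⟨b, rfl⟩ := Ideal.mem_span_singleton'.1 this
    simp [mul_smul, hm]
  refine ⟨Submodule.torsionBy R M (x ^ N), Module.Finite.iff_fg.1 (hfg N), ?_, ?_⟩
  · let A := LinearMap.range (LinearMap.lsmul R M (x ^ N))
    have e : (M ⧸ Submodule.torsionBy R M (x ^ N)) ≃ₗ[R] A :=
      (LinearMap.lsmul R M (x ^ N)).quotKerEquivRange
    suffices IsArtinian R A from isArtinian_of_linearEquiv e.symm
    have hsA : ∀ a : A, s • a = 0 := by
      rintro ⟨_, m, rfl⟩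
      apply Subtype.ext
      simp [smul_smul, hs]
    apply melk17 (x := x)
    · rintro ⟨m, hm⟩
      obtain ⟨n, hn⟩ := ht m
      exact ⟨n, Subtype.ext (hn _ (Ideal.pow_mem_pow hxI n))⟩
    · have : IsNoetherian R (Submodule.torsionBy R A x) := by
        have h1 := hfg 1
        have : IsNoetherian R (Submodule.torsionBy R M (x ^ 1)) := inferInstance
        refine isNoetherian_of_injective ((A.subtype.comp (Submodule.subtype _)).codRestrict
          (Submodule.torsionBy R M (x ^ 1)) ?_) ?_
        · rintro ⟨a, ha⟩
          rw [Submodule.mem_torsionBy_iff] at ha ⊢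
          simpa using congrArg Subtype.val ha
        · intro a b hab
          exact Subtype.ext (Subtype.ext (by simpa using congrArg Subtype.val hab))
      refine (noeth_iff_art17 (Ideal.span {x, s}) ?_).1 this
      apply torsionPair17
      · rintro ⟨a, ha⟩
        exact Subtype.ext ha
      · rintro ⟨a, ha⟩
        exact Subtype.ext (hsA a)
  · intro m
    rw [Submodule.mem_torsionBy_iff, smul_smul, mul_comm, hs, zero_smul]
end A

section B
variable {R : Type} [CommRing R] [IsNoetherianRing R]

theorem exCover17 (X : Type) [AddCommGroup X] [Module R X] (N : Submodule R X) (hN : N.FG) :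
    ∃ (k : ℕ) (f : (Fin k → R) →ₗ[R] X), LinearMap.range f = N := by
  obtain ⟨k, g, hg⟩ := Submodule.fg_iff_exists_fin_generating_family.1 hN
  exact ⟨k, Fintype.linearCombination R g, by rw [Fintype.range_linearCombination, hg]⟩

/-- successive kernels -/
noncomputable def seq17 (k : ℕ) (K : Submodule R (Fin k → R)) :
    ℕ → Σ k : ℕ, Submodule R (Fin k → R)
  | 0 => ⟨k, K⟩
  | n + 1 =>
    ⟨(exCover17 _ (seq17 k K n).2 (IsNoetherian.noetherian _)).choose,
      LinearMap.ker (exCover17 _ (seq17 k K n).2 (IsNoetherian.noetherian _)).choose_spec.choose⟩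

noncomputable def seqD17 (k : ℕ) (K : Submodule R (Fin k → R)) (n : ℕ) :
    (Fin (seq17 k K (n + 1)).1 → R) →ₗ[R] (Fin (seq17 k K n).1 → R) :=
  (exCover17 _ (seq17 k K n).2 (IsNoetherian.noetherian _)).choose_spec.choose

theorem seqD17_range (k : ℕ) (K : Submodule R (Fin k → R)) (n : ℕ) :
    LinearMap.range (seqD17 k K n) = (seq17 k K n).2 :=
  (exCover17 _ (seq17 k K n).2 (IsNoetherian.noetherian _)).choose_spec.choose_spec

theorem seqD17_ker (k : ℕ) (K : Submodule R (Fin k → R)) (n : ℕ) :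
    LinearMap.ker (seqD17 k K n) = (seq17 k K (n + 1)).2 := rfl

noncomputable def cpx17 (k : ℕ) (K : Submodule R (Fin k → R)) : ChainComplex (ModuleCat.{0} R) ℕ :=
  ChainComplex.of (fun n => ModuleCat.of R (Fin (seq17 k K n).1 → R))
    (fun n => ModuleCat.ofHom (seqD17 k K n)) (by
      intro n
      ext1
      rw [ModuleCat.hom_comp]
      exact LinearMap.range_le_ker_iff.1 (by rw [ModuleCat.hom_ofHom, ModuleCat.hom_ofHom, seqD17_range, seqD17_ker]))

theorem cpx17_d (k : ℕ) (K : Submodule R (Fin k → R)) (n : ℕ) :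
    (cpx17 k K).d (n+1) n = ModuleCat.ofHom (seqD17 k K n) :=
  ChainComplex.of_d (fun n => ModuleCat.of R (Fin (seq17 k K n).1 → R))
    (fun n => ModuleCat.ofHom (seqD17 k K n)) n

theorem cpx17_range (k : ℕ) (K : Submodule R (Fin k → R)) (n : ℕ) :
    LinearMap.range ((cpx17 k K).d (n+1) n).hom = (seq17 k K n).2 :=
  (congrArg (fun φ : ModuleCat.of R (Fin (seq17 k K (n+1)).1 → R) ⟶
    ModuleCat.of R (Fin (seq17 k K n).1 → R) => LinearMap.range φ.hom) (cpx17_d k K n)).trans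
    (seqD17_range k K n)

theorem cpx17_ker (k : ℕ) (K : Submodule R (Fin k → R)) (n : ℕ) :
    LinearMap.ker ((cpx17 k K).d (n+1) n).hom = (seq17 k K (n+1)).2 :=
  (congrArg (fun φ : ModuleCat.of R (Fin (seq17 k K (n+1)).1 → R) ⟶
    ModuleCat.of R (Fin (seq17 k K n).1 → R) => LinearMap.ker φ.hom) (cpx17_d k K n)).trans
    (seqD17_ker k K n)

theorem cpx17_exact (k : ℕ) (K : Submodule R (Fin k → R)) (n : ℕ) :
    (cpx17 k K).ExactAt (n + 1) := by
  rw [HomologicalComplex.exactAt_iff' _ (n + 1 + 1) (n + 1) n (by simp) (by simp),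
    ShortComplex.moduleCat_exact_iff_range_eq_ker]
  exact (cpx17_range k K (n+1)).trans (cpx17_ker k K n).symm

theorem exRes17 (X : ModuleCat.{0} R) [Module.Finite R X] :
    ∃ P : ProjectiveResolution X, ∀ n, Module.Finite R (P.complex.X n) := by
  obtain ⟨k, f, hf⟩ := exCover17 (R := R) X ⊤ Module.Finite.fg_top
  let g : (cpx17 k (LinearMap.ker f)).X 0 ⟶ X := ModuleCat.ofHom f
  have hr : LinearMap.range ((cpx17 k (LinearMap.ker f)).d 1 0).hom = LinearMap.ker g.hom :=
    cpx17_range k (LinearMap.ker f) 0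
  have hg : (cpx17 k (LinearMap.ker f)).d 1 0 ≫ g = 0 := by
    ext1
    rw [ModuleCat.hom_comp]
    exact LinearMap.range_le_ker_iff.1 hr.le
  have hE : Epi g := (ModuleCat.epi_iff_range_eq_top _).2 hf
  have hex : (ShortComplex.mk _ _ hg).Exact := by
    rw [ShortComplex.moduleCat_exact_iff_range_eq_ker]
    exact hr
  refine ⟨{ complex := cpx17 k (LinearMap.ker f)
            projective := fun n => ?_
            π := (ChainComplex.toSingle₀Equiv _ _).symm ⟨g, hg⟩
            quasiIso := ⟨fun n => ?_⟩ }, fun n => ?_⟩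
  · change Projective (ModuleCat.of R (Fin (seq17 k (LinearMap.ker f) n).1 → R))
    infer_instance
  · cases n with
    | zero =>
      rw [ChainComplex.quasiIsoAt₀_iff, ShortComplex.quasiIso_iff_of_zeros']
      · refine (ShortComplex.exact_and_epi_g_iff_of_iso ?_).2 ⟨hex, hE⟩
        exact ShortComplex.isoMk (Iso.refl _) (Iso.refl _) (Iso.refl _)
          ((Category.id_comp _).trans (Category.comp_id _).symm)
          ((Category.id_comp _).trans ((Category.comp_id _).trans (by simp)).symm)
      all_goals rfl
    | succ n =>
      rw [quasiIsoAt_iff_exactAt']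
      · apply cpx17_exact
      · apply ChainComplex.exactAt_succ_single_obj
  · change Module.Finite R (Fin (seq17 k (LinearMap.ker f) n).1 → R)
    infer_instance
end B

section C
variable {R : Type} [CommRing R] {X : ModuleCat.{0} R}

theorem mem_ker17 (P : ProjectiveResolution X) (Y : ModuleCat.{0} R) (n j : ℕ)
    (hj : (ComplexShape.up ℕ).next n = j) (z : P.complex.X n ⟶ Y) :
    z ∈ LinearMap.ker ((P.complex.linearYonedaObj R Y).sc n).g.hom ↔ P.complex.d j n ≫ z = 0 := by
  subst hj
  exact Iff.rfl

theorem mem_range17 (P : ProjectiveResolution X) (Y : ModuleCat.{0} R) (n j : ℕ)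
    (hj : (ComplexShape.up ℕ).prev n = j) (z : P.complex.X n ⟶ Y) :
    z ∈ LinearMap.range ((P.complex.linearYonedaObj R Y).sc n).f.hom ↔
      ∃ w : P.complex.X j ⟶ Y, P.complex.d n j ≫ w = z := by
  subst hj
  exact Iff.rfl

noncomputable def extEquiv17 (P : ProjectiveResolution X) (Y : ModuleCat.{0} R) (n : ℕ) :
    (((Ext R (ModuleCat.{0} R) n).obj (Opposite.op X)).obj Y) ≃ₗ[R]
    (LinearMap.ker ((P.complex.linearYonedaObj R Y).sc n).g.hom ⧸
      LinearMap.range ((P.complex.linearYonedaObj R Y).sc n).moduleCatToCycles) :=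
  ((P.isoExt n Y) ≪≫ ((P.complex.linearYonedaObj R Y).sc n).moduleCatHomologyIso).toLinearEquiv

theorem smul_bdry17 (P : ProjectiveResolution X) (Y : ModuleCat.{0} R) (n : ℕ) (a : R)
    (ha : ∀ m : X, a • m = 0) (z : P.complex.X n ⟶ Y)
    (hz : P.complex.d (n+1) n ≫ z = 0) :
    a • z ∈ LinearMap.range ((P.complex.linearYonedaObj R Y).sc n).f.hom := by
  have hc : (a • 𝟙 P.complex) ≫ P.π = 0 := by
    refine HomologicalComplex.to_single_hom_ext ?_
    ext m
    have h0 : ∀ m : ((ChainComplex.single₀ (ModuleCat.{0} R)).obj X).X 0, a • m = 0 := ha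
    change (P.π.f 0).hom (a • m) = 0
    rw [map_smul, h0]
  have H := ProjectiveResolution.liftHomotopyZero _ hc
  have h1 : a • 𝟙 (P.complex.X n) = dNext n H.hom + prevD n H.hom := by
    have := H.comm n
    simpa using this
  have h2 : a • z = dNext n H.hom ≫ z := by
    have : a • z = (a • 𝟙 (P.complex.X n)) ≫ z := by simp
    rw [this, h1, Preadditive.add_comp, prevD_eq (j' := n+1) _ (by simp), Category.assoc, hz]
    simp
  rw [h2]
  cases n with
  | zero =>
    rw [dNext_eq_zero _ _ (by simp), Limits.zero_comp]
    exact Submodule.zero_mem _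
  | succ n =>
    rw [mem_range17 P Y (n+1) n (by simp), dNext_eq (i' := n) _ (by simp)]
    exact ⟨H.hom n (n+1) ≫ z, by simp⟩

theorem ext_smul17 (Y : ModuleCat.{0} R) (n : ℕ) (a : R)
    (ha : ∀ m : X, a • m = 0) (e : (((Ext R (ModuleCat.{0} R) n).obj (Opposite.op X)).obj Y)) :
    a • e = 0 := by
  let P : ProjectiveResolution X := ProjectiveResolution.of X
  apply (extEquiv17 P Y n).injective
  rw [map_smul, map_zero]
  obtain ⟨⟨z, hz⟩, h⟩ := Submodule.Quotient.mk_surjective _ (extEquiv17 P Y n e)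
  rw [← h, ← Submodule.Quotient.mk_smul, Submodule.Quotient.mk_eq_zero]
  obtain ⟨w, hw⟩ := smul_bdry17 P Y n a ha z ((mem_ker17 P Y n (n+1) (by simp) z).1 hz)
  exact ⟨w, Subtype.ext hw⟩

theorem DC17.ext [IsNoetherianRing R] [Module.Finite R X] (Y : ModuleCat.{0} R) (n : ℕ) (s : R) (h : DC17 R s Y) :
    DC17 R s (((Ext R (ModuleCat.{0} R) n).obj (Opposite.op X)).obj Y) := by
  obtain ⟨P, hP⟩ := exRes17 X
  have hPn := hP n
  obtain ⟨k, f, hf⟩ := exCover17 (R := R) (P.complex.X n) ⊤ Module.Finite.fg_top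
  have h1 : DC17 R s (P.complex.X n ⟶ Y) := by
    let φ : (P.complex.X n ⟶ Y) →ₗ[R] (Fin k → Y) :=
      { toFun := fun z i => z.hom (f (Pi.single i 1))
        map_add' := fun _ _ => rfl
        map_smul' := fun _ _ => rfl }
    refine (h.pi k).of_injective φ ?_
    intro z w hzw
    have : z.hom.comp f = w.hom.comp f := by
      refine LinearMap.pi_ext' fun i => ?_
      ext
      exact congrFun hzw i
    ext m
    obtain ⟨m, rfl⟩ := LinearMap.range_eq_top.1 hf m
    exact LinearMap.congr_fun this m
  have h2 : DC17 R s (LinearMap.ker ((P.complex.linearYonedaObj R Y).sc n).g.hom) :=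
    DC17.of_injective (M := (P.complex.X n ⟶ Y)) (Submodule.subtype _) (Submodule.subtype_injective _) h1
  have h3 := h2.of_surjective (Submodule.mkQ
    (LinearMap.range ((P.complex.linearYonedaObj R Y).sc n).moduleCatToCycles))
    (Submodule.mkQ_surjective _)
  exact h3.of_injective (extEquiv17 P Y n).toLinearMap (extEquiv17 P Y n).injective

/-- `Ext^0(R/I,Y)` finite implies `0 :_Y I` finite. -/
theorem ext_zero17 [IsNoetherianRing R] (I : Ideal R) (Y : ModuleCat.{0} R)
    (h : Module.Finite R (((Ext R (ModuleCat.{0} R) 0).obj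
      (Opposite.op (ModuleCat.of R (R ⧸ I)))).obj Y)) :
    Module.Finite R (Submodule.torsionBySet R Y (I : Set R)) := by
  let P : ProjectiveResolution (ModuleCat.of R (R ⧸ I)) := ProjectiveResolution.of _
  let K := P.complex.linearYonedaObj R Y
  have hq : Module.Finite R (LinearMap.ker (K.sc 0).g.hom ⧸
      LinearMap.range (K.sc 0).moduleCatToCycles) := Module.Finite.equiv (extEquiv17 P Y 0)
  have hb : LinearMap.range (K.sc 0).moduleCatToCycles = ⊥ := by
    rw [eq_bot_iff]
    rintro z ⟨w, rfl⟩
    obtain ⟨w', hw'⟩ := (mem_range17 P Y 0 0 (by simp) ((K.sc 0).f.hom w)).1 ⟨w, rfl⟩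
    rw [P.complex.shape _ _ (by simp), Limits.zero_comp] at hw'
    exact Subtype.ext hw'.symm
  let E := (Submodule.quotEquivOfEqBot _ hb)
  have hk : Module.Finite R (LinearMap.ker (K.sc 0).g.hom) := Module.Finite.equiv E
  have : IsNoetherian R (LinearMap.ker (K.sc 0).g.hom) := inferInstance
  let π0 : P.complex.X 0 ⟶ ModuleCat.of R (R ⧸ I) := P.π.f 0
  have hπ : Epi π0 := inferInstanceAs (Epi (P.π.f 0))
  have hd : P.complex.d 1 0 ≫ π0 = 0 := P.complex_d_comp_π_f_zero
  let ψ : Submodule.torsionBySet R Y (I : Set R) → (ModuleCat.of R (R ⧸ I) ⟶ Y) := fun y =>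
    ModuleCat.ofHom (Submodule.liftQ I (LinearMap.toSpanSingleton R Y y) (by
      intro a ha
      exact (Submodule.mem_torsionBySet_iff _ _).1 y.2 ⟨a, ha⟩))
  have hψ1 : ∀ y a, (ψ y).hom (Ideal.Quotient.mk I a) = a • (y : Y) := fun y a => rfl
  have hψ : ∀ (y : Submodule.torsionBySet R Y (I : Set R)) (f : (ModuleCat.of R (R ⧸ I) ⟶ Y)), (∀ a, f.hom (Ideal.Quotient.mk I a) = a • (y : Y)) → ψ y = f := by
    intro y f hf
    refine ModuleCat.hom_ext (LinearMap.ext fun m => ?_)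
    obtain ⟨m, rfl⟩ := Ideal.Quotient.mk_surjective m
    exact (hf m).symm
  let Φ : Submodule.torsionBySet R Y (I : Set R) →ₗ[R] LinearMap.ker (K.sc 0).g.hom :=
    { toFun := fun y => ⟨π0 ≫ ψ y, (mem_ker17 P Y 0 1 (by simp) _).2 (by
        rw [← Category.assoc, hd, Limits.zero_comp])⟩
      map_add' := by
        intro y y'
        apply Subtype.ext
        have : ψ (y + y') = ψ y + ψ y' := hψ _ _ (fun a => (smul_add a (y : Y) y').symm)
        change π0 ≫ ψ (y + y') = π0 ≫ ψ y + π0 ≫ ψ y'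
        rw [this, Preadditive.comp_add]
      map_smul' := by
        intro a y
        apply Subtype.ext
        have : ψ (a • y) = a • ψ y := hψ _ _ (fun b => by
          change a • (b • (y : Y)) = b • (a • (y : Y))
          rw [smul_comm])
        change π0 ≫ ψ (a • y) = a • (π0 ≫ ψ y)
        rw [this, Linear.comp_smul] }
  refine Module.Finite.of_injective Φ ?_
  intro y y' hyy
  have h1 : π0 ≫ ψ y = π0 ≫ ψ y' := congrArg Subtype.val hyy
  have h2 : ψ y = ψ y' := (cancel_epi π0).1 h1
  have h3 := hψ1 y 1
  rw [h2, hψ1] at h3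
  apply Subtype.ext
  simpa using h3.symm
end C


section D
variable {R : Type} [CommRing R] [IsNoetherianRing R]

theorem unif17 {M : Type} [AddCommGroup M] [Module R M] (x : M) (I J : Ideal R)
    (h : ∀ a ∈ J, ∃ N : ℕ, ∀ b ∈ I ^ N, b • a • x = 0) :
    ∃ N : ℕ, ∀ a ∈ J, ∀ b ∈ I ^ N, b • a • x = 0 := by
  let A : ℕ →o Ideal R :=
    { toFun := fun N =>
        { carrier := {a | ∀ b ∈ I ^ N, b • a • x = 0}
          add_mem' := by
            intro a a' ha ha' b hb
            rw [add_smul, smul_add, ha b hb, ha' b hb, add_zero]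
          zero_mem' := by
            intro b hb
            simp
          smul_mem' := by
            intro c a ha b hb
            rw [smul_eq_mul, mul_smul, smul_comm, ha b hb, smul_zero] }
      monotone' := by
        intro n n' hn a ha b hb
        exact ha b (Ideal.pow_le_pow_right hn hb) }
  obtain ⟨n, hn⟩ := monotone_stabilizes_iff_noetherian.2 (inferInstance : IsNoetherian R R) A
  refine ⟨n, fun a ha => ?_⟩
  obtain ⟨N, hN⟩ := h a ha
  have h1 : a ∈ A N := hN
  have h2 : a ∈ A n := by
    rcases le_total n N with h | h
    · rw [hn N h]; exact h1
    · exact A.monotone h h1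
  exact h2

theorem tors_of_supp17 (I : Ideal R) (M : ModuleCat.{0} R)
    (h : Module.support R M ⊆ PrimeSpectrum.zeroLocus (I : Set R)) :
    IsTorsionByPowers R I M := by
  intro m
  have h1 : I ≤ (Ideal.torsionOf R M m).radical := by
    rw [Ideal.radical_eq_sInf]
    refine le_sInf ?_
    rintro P ⟨hP, hPp⟩
    have : (⟨P, hPp⟩ : PrimeSpectrum R) ∈ Module.support R M := by
      rw [Module.mem_support_iff_exists_annihilator]
      refine ⟨m, ?_⟩
      intro a ha
      apply hP
      rw [Ideal.mem_torsionOf_iff]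
      exact (Submodule.mem_annihilator_span_singleton _ _).1 ha
    exact h this
  obtain ⟨n, hn⟩ := Ideal.exists_pow_le_of_le_radical_of_fg h1 (IsNoetherian.noetherian I)
  exact ⟨n, fun a ha => (Ideal.mem_torsionOf_iff _ _).1 (hn ha)⟩

theorem supp_of_tors17 (I : Ideal R) (M : ModuleCat.{0} R)
    (h : IsTorsionByPowers R I M) :
    Module.support R M ⊆ PrimeSpectrum.zeroLocus (I : Set R) := by
  intro P hP
  rw [Module.mem_support_iff_exists_annihilator] at hP
  obtain ⟨m, hm⟩ := hP
  obtain ⟨n, hn⟩ := h m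
  have h1 : I ^ n ≤ P.asIdeal := by
    intro a ha
    exact hm ((Submodule.mem_annihilator_span_singleton _ _).2 (hn a ha))
  exact P.2.le_of_pow_le h1

/-- ideals for which the finiteness criterion works -/
def Good17 (R : Type) [CommRing R] (I : Ideal R) : Prop :=
  ∃ (x s : R) (k N : ℕ), x ∈ I ∧ I ^ k ≤ Ideal.span {x} ∧ s * x ^ N = 0 ∧
    IsArtinianRing (R ⧸ Ideal.span {x, s})

theorem cof_iff17 (I : Ideal R) (hI : Good17 R I) (M : ModuleCat.{0} R) :
    IsCofiniteWrt R I M ↔ IsTorsionByPowers R I M ∧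
      Module.Finite R (Submodule.torsionBySet R M (I : Set R)) := by
  constructor
  · rintro ⟨h1, h2⟩
    exact ⟨tors_of_supp17 I M h1, ext_zero17 I M (h2 0)⟩
  · rintro ⟨h1, h2⟩
    obtain ⟨x, s, k, N, hx, hk, hs, hart⟩ := hI
    refine ⟨supp_of_tors17 I M h1, fun i => ?_⟩
    have h3 : DC17 R s M := DC17.of_torsion I hx k N hk hs hart h1 h2
    have : Module.Finite R (ModuleCat.of R (R ⧸ I)) := inferInstanceAs (Module.Finite R (R ⧸ I))
    refine DC17.finite hart (DC17.ext (X := ModuleCat.of R (R ⧸ I)) M i s h3) ?_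
    refine ext_smul17 M i x ?_
    intro m
    obtain ⟨m, rfl⟩ := Ideal.Quotient.mk_surjective m
    change Ideal.Quotient.mk I (x * m) = 0
    exact Ideal.Quotient.eq_zero_iff_mem.2 (I.mul_mem_right _ hx)

section dim
variable [IsLocalRing R]

theorem min_or_max17 (hdim : ringKrullDim R = 1) (P : Ideal R) (hP : P.IsPrime) :
    P ∈ minimalPrimes R ∨ P = IsLocalRing.maximalIdeal R := by
  have : Ring.KrullDimLE 1 R := (Ring.krullDimLE_iff).2 (by rw [hdim]; rfl)
  rcases Ring.krullDimLE_one_iff.1 this P hP with h | h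
  · exact Or.inl h
  · exact Or.inr (IsLocalRing.eq_maximalIdeal h)

theorem max_not_min17 (hdim : ringKrullDim R = 1) :
    IsLocalRing.maximalIdeal R ∉ minimalPrimes R := by
  intro h
  have : Ring.KrullDimLE 0 R := by
    rw [Ring.krullDimLE_zero_iff]
    intro P hP
    have h1 : P ≤ IsLocalRing.maximalIdeal R := IsLocalRing.le_maximalIdeal hP.ne_top
    have h2 := h.2 ⟨hP, bot_le⟩ h1
    rw [le_antisymm h1 h2]
    infer_instance
  have h2 := Ring.krullDimLE_iff.1 this
  rw [hdim] at h2
  exact absurd h2 (by norm_num)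

theorem art17 (J : Ideal R) (h : ∀ P : Ideal R, P.IsPrime → J ≤ P → P = IsLocalRing.maximalIdeal R) :
    IsArtinianRing (R ⧸ J) := by
  rw [isArtinianRing_iff_krullDimLE_zero,
    Ideal.krullDimLE_zero_quotient_iff_forall_minimalPrimes_isMaximal]
  intro P hP
  rw [h P hP.1.1 hP.1.2]
  infer_instance

theorem le_rad17 (I J : Ideal R) (h : ∀ P : Ideal R, P.IsPrime → J ≤ P → I ≤ P) :
    ∃ k, I ^ k ≤ J := by
  refine Ideal.exists_pow_le_of_le_radical_of_fg ?_ (IsNoetherian.noetherian I)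
  rw [Ideal.radical_eq_sInf]
  exact le_sInf fun P hP => h P hP.2 hP.1

theorem avoid17 (I : Ideal R) (S : Set (Ideal R)) (hS : S ⊆ minimalPrimes R)
    (h : ∀ P ∈ S, ¬ I ≤ P) : ∃ x ∈ I, ∀ P ∈ S, x ∉ P := by
  have hf : S.Finite := (minimalPrimes.finite_of_isNoetherianRing R).subset hS
  by_contra hc
  push Not at hc
  have h1 := (Ideal.subset_union_prime_finite (R := R) hf (f := id) (I := I) ⊥ ⊥
    (fun P hP _ _ => (hS hP).1.1)).1 (by
      intro x hx
      obtain ⟨P, hP, hxP⟩ := hc x hx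
      simp only [Set.mem_iUnion]
      exact ⟨P, hP, hxP⟩)
  obtain ⟨P, hP, hle⟩ := h1
  exact h P hP hle

theorem good_max17 (hdim : ringKrullDim R = 1) : Good17 R (IsLocalRing.maximalIdeal R) := by
  obtain ⟨x, hx, hxP⟩ := avoid17 (IsLocalRing.maximalIdeal R) (minimalPrimes R) le_rfl (by
    intro P hP hle
    have := (IsLocalRing.maximalIdeal.isMaximal R).eq_of_le hP.1.1.ne_top hle
    exact max_not_min17 hdim (this ▸ hP))
  have h1 : ∀ P : Ideal R, P.IsPrime → x ∈ P → P = IsLocalRing.maximalIdeal R := by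
    intro P hP hx
    rcases min_or_max17 hdim P hP with h | h
    · exact absurd hx (hxP P h)
    · exact h
  obtain ⟨k, hk⟩ := le_rad17 (IsLocalRing.maximalIdeal R) (Ideal.span {x}) (by
    intro P hP hle
    rw [h1 P hP (hle (Ideal.mem_span_singleton_self x))])
  refine ⟨x, 0, k, 0, hx, hk, by simp, art17 _ ?_⟩
  intro P hP hle
  exact h1 P hP (hle (Ideal.subset_span (by simp)))

theorem good_min17 (hdim : ringKrullDim R = 1) (p : Ideal R) (hp : p ∈ minimalPrimes R) :
    Good17 R p := by
  have hpp : p.IsPrime := hp.1.1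
  have hmin : ∀ P ∈ minimalPrimes R, P ≤ p → P = p := fun P hP h =>
    le_antisymm h (hp.2 hP.1 h)
  obtain ⟨x, hx, hxP⟩ := avoid17 p (minimalPrimes R \ {p}) Set.sdiff_subset (by
    intro P hP hle
    exact hP.2 (le_antisymm (hP.1.2 hp.1 hle) hle))
  have hf : (minimalPrimes R \ {p}).Finite :=
    (minimalPrimes.finite_of_isNoetherianRing R).subset Set.sdiff_subset
  have : ∃ s0 : R, s0 ∉ p ∧ ∀ P ∈ minimalPrimes R, P ≠ p → s0 ∈ P := by
    by_contra hc
    push Not at hc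
    have h1 : hf.toFinset.inf id ≤ p := by
      intro a ha
      by_contra hap
      obtain ⟨P, hP, hne, haP⟩ := hc a hap
      apply haP
      exact (Finset.inf_le (f := id) (show P ∈ hf.toFinset by simp [hP, hne])) ha
    obtain ⟨P, hP, hle⟩ := (Ideal.IsPrime.inf_le' hpp).1 h1
    have hP' : P ∈ minimalPrimes R \ {p} := by simpa using hP
    exact hP'.2 (hmin P hP'.1 hle)
  obtain ⟨s0, hs0, hs0P⟩ := this
  have hnil : IsNilpotent (s0 * x) := by
    rw [← mem_nilradical, nilradical, ← Ideal.sInf_minimalPrimes, Ideal.mem_sInf]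
    intro P hP
    by_cases h : P = p
    · rw [h]; exact p.mul_mem_left _ hx
    · exact P.mul_mem_right _ (hs0P P hP h)
  obtain ⟨N, hN⟩ := hnil
  have hmax : ∀ P : Ideal R, P.IsPrime → x ∈ P → P = p ∨ P = IsLocalRing.maximalIdeal R := by
    intro P hP hx
    rcases min_or_max17 hdim P hP with h | h
    · by_cases h' : P = p
      · exact Or.inl h'
      · exact absurd hx (hxP P ⟨h, h'⟩)
    · exact Or.inr h
  obtain ⟨k, hk⟩ := le_rad17 p (Ideal.span {x}) (by
    intro P hP hle
    rcases hmax P hP (hle (Ideal.mem_span_singleton_self x)) with h | h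
    · rw [h]
    · rw [h]; exact IsLocalRing.le_maximalIdeal hpp.ne_top)
  refine ⟨x, s0 ^ N, k, N, hx, hk, by rw [← mul_pow, hN], art17 _ ?_⟩
  intro P hP hle
  have h1 : x ∈ P := hle (Ideal.subset_span (by simp))
  have h2 : s0 ^ N ∈ P := hle (Ideal.subset_span (by simp))
  rcases hmax P hP h1 with h | h
  · exact absurd (hpp.mem_of_pow_mem N (h ▸ h2)) hs0
  · exact h

theorem part1_17 (hdim : ringKrullDim R = 1) (q : Ideal R) (hq : q ≤ IsLocalRing.maximalIdeal R) :
    MelkerssonCondition R (IsCofiniteWrt R (IsLocalRing.maximalIdeal R)) q := by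
  intro M hM h
  rw [cof_iff17 _ (good_max17 hdim)] at h ⊢
  obtain ⟨h1, h2⟩ := h
  set I := IsLocalRing.maximalIdeal R with hI
  constructor
  · have key : ∀ n : ℕ, ∀ x : M, (∀ a ∈ q ^ n, a • x = 0) → ∃ N : ℕ, ∀ b ∈ I ^ N, b • x = 0 := by
      intro n
      induction n with
      | zero =>
        intro x hx
        refine ⟨0, fun b _ => ?_⟩
        exact hx b (by simp)
      | succ n ih =>
        intro x hx
        obtain ⟨N, hN⟩ := unif17 x I q (fun a ha => ih (a • x) (by
          intro b hb
          rw [← mul_smul]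
          exact hx _ (by rw [pow_succ]; exact Ideal.mul_mem_mul hb ha)))
        obtain ⟨K, hK⟩ := unif17 x I (I ^ N) (fun b hb => by
          have hmem : b • x ∈ Submodule.torsionBySet R M (q : Set R) := by
            rw [Submodule.mem_torsionBySet_iff]
            rintro ⟨a, ha⟩
            change a • b • x = 0
            rw [smul_comm]
            exact hN a ha b hb
          obtain ⟨L, hL⟩ := h1 ⟨b • x, hmem⟩
          exact ⟨L, fun c hc => congrArg Subtype.val (hL c hc)⟩)
        refine ⟨K + N, fun b hb => ?_⟩
        have : I ^ (K + N) ≤ Ideal.torsionOf R M x := by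
          rw [pow_add, Ideal.mul_le]
          intro c hc d hd
          rw [Ideal.mem_torsionOf_iff, mul_smul]
          exact hK d hd c hc
        exact (Ideal.mem_torsionOf_iff _ _).1 (this hb)
    intro x
    obtain ⟨n, hn⟩ := hM x
    exact key n x hn
  · have hle : ∀ y : Submodule.torsionBySet R M (I : Set R),
        (y : M) ∈ Submodule.torsionBySet R M (q : Set R) := by
      intro y
      rw [Submodule.mem_torsionBySet_iff]
      rintro ⟨a, ha⟩
      exact (Submodule.mem_torsionBySet_iff _ _).1 y.2 ⟨a, hq ha⟩
    let T : ModuleCat.{0} R := ModuleCat.of R (Submodule.torsionBySet R M (q : Set R))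
    let φ : Submodule.torsionBySet R M (I : Set R) →ₗ[R] Submodule.torsionBySet R T (I : Set R) :=
      { toFun := fun y => ⟨⟨y, hle y⟩, (Submodule.mem_torsionBySet_iff _ _).2 (by
          rintro ⟨a, ha⟩
          exact Subtype.ext ((Submodule.mem_torsionBySet_iff _ _).1 y.2 ⟨a, ha⟩))⟩
        map_add' := fun _ _ => rfl
        map_smul' := fun _ _ => rfl }
    have : Module.Finite R (Submodule.torsionBySet R T (I : Set R)) := h2
    refine Module.Finite.of_injective φ ?_
    intro y y' hy
    apply Subtype.ext
    exact congrArg (fun z => ((z : T) : M)) (congrArg Subtype.val hy)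

theorem part2a_17 (p : Ideal R) (hg : Good17 R p) :
    MelkerssonCondition R (IsCofiniteWrt R p) p := by
  intro M hM h
  rw [cof_iff17 _ hg] at h ⊢
  refine ⟨hM, ?_⟩
  let T : ModuleCat.{0} R := ModuleCat.of R (Submodule.torsionBySet R M (p : Set R))
  let φ : Submodule.torsionBySet R M (p : Set R) →ₗ[R] Submodule.torsionBySet R T (p : Set R) :=
    { toFun := fun y => ⟨y, (Submodule.mem_torsionBySet_iff _ _).2 (by
        rintro ⟨a, ha⟩
        exact Subtype.ext ((Submodule.mem_torsionBySet_iff _ _).1 y.2 ⟨a, ha⟩))⟩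
      map_add' := fun _ _ => rfl
      map_smul' := fun _ _ => rfl }
  have : Module.Finite R (Submodule.torsionBySet R T (p : Set R)) := h.2
  refine Module.Finite.of_injective φ ?_
  intro y y' hy
  exact congrArg Subtype.val hy

/-- the test module: `A[1/y] / A` with `A = R/p` -/
theorem exMod17 (p : Ideal R) (hp : p.IsPrime) (y : R) (hy : y ∉ p)
    (hym : y ∈ IsLocalRing.maximalIdeal R) :
    ∃ (M : ModuleCat.{0} R), (∀ a ∈ p, ∀ m : M, a • m = 0) ∧
      (∀ m : M, ∃ n : ℕ, y ^ n • m = 0) ∧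
      (∃ u : M, ∀ m : M, y • m = 0 → ∃ a : R, m = a • u) ∧
      (∀ n : ℕ, ∃ m : M, y ^ n • m ≠ 0) := by
  let A := R ⧸ p
  let yb : A := Ideal.Quotient.mk p y
  have hyb : yb ≠ 0 := fun h => hy (Ideal.Quotient.eq_zero_iff_mem.1 h)
  let L := Localization.Away yb
  have hinj : Function.Injective (algebraMap A L) :=
    IsLocalization.injective L (powers_le_nonZeroDivisors_of_noZeroDivisors hyb)
  let N : Submodule R L := LinearMap.range (Algebra.linearMap A L |>.restrictScalars R)
  have hN : ∀ z : L, z ∈ N ↔ ∃ a : A, algebraMap A L a = z := fun z => Iff.rfl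
  let v : L := IsLocalization.Away.invSelf yb
  have hv : algebraMap A L yb * v = 1 := IsLocalization.Away.mul_invSelf yb
  have hsm : ∀ (a : R) (z : L), a • z = algebraMap A L (Ideal.Quotient.mk p a) * z := by
    intro a z
    rw [← algebraMap_smul A a z, Algebra.smul_def]
    rfl
  have hvn : ∀ n : ℕ, algebraMap A L yb ^ n * v ^ n = 1 := fun n => by rw [← mul_pow, hv, one_pow]
  refine ⟨ModuleCat.of R (L ⧸ N), ?_, ?_, ?_, ?_⟩
  · intro a ha m
    obtain ⟨z, rfl⟩ := Submodule.Quotient.mk_surjective N m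
    rw [← Submodule.Quotient.mk_smul, hsm, Ideal.Quotient.eq_zero_iff_mem.2 ha, map_zero, zero_mul,
      Submodule.Quotient.mk_zero]
  · intro m
    obtain ⟨z, rfl⟩ := Submodule.Quotient.mk_surjective N m
    obtain ⟨n, a, h⟩ := IsLocalization.Away.surj yb z
    refine ⟨n, ?_⟩
    rw [← Submodule.Quotient.mk_smul, Submodule.Quotient.mk_eq_zero, hN]
    refine ⟨a, ?_⟩
    rw [hsm, map_pow, map_pow, ← h, mul_comm]
  · refine ⟨Submodule.Quotient.mk v, ?_⟩
    intro m hm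
    obtain ⟨z, rfl⟩ := Submodule.Quotient.mk_surjective N m
    rw [← Submodule.Quotient.mk_smul, Submodule.Quotient.mk_eq_zero, hN] at hm
    obtain ⟨a, ha⟩ := hm
    obtain ⟨a, rfl⟩ := Ideal.Quotient.mk_surjective a
    refine ⟨a, ?_⟩
    rw [← Submodule.Quotient.mk_smul]
    congr 1
    rw [hsm, ha, hsm, mul_right_comm]
    change z = algebraMap A L yb * v * z
    rw [hv, one_mul]
  · intro n
    refine ⟨Submodule.Quotient.mk (v ^ (n + 1)), ?_⟩
    intro h
    rw [← Submodule.Quotient.mk_smul, Submodule.Quotient.mk_eq_zero, hN] at h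
    obtain ⟨a, ha⟩ := h
    rw [hsm, map_pow, map_pow, pow_succ, ← mul_assoc] at ha
    change _ = algebraMap A L yb ^ n * v ^ n * v at ha
    rw [hvn, one_mul] at ha
    have h1 : yb * a = 1 := by
      apply hinj
      rw [map_mul, ha, hv, map_one]
    obtain ⟨a, rfl⟩ := Ideal.Quotient.mk_surjective a
    have h2 : y * a - 1 ∈ p := by
      rw [← Ideal.Quotient.eq_zero_iff_mem, map_sub, map_mul, map_one, sub_eq_zero]
      exact h1
    have h3 := IsLocalRing.le_maximalIdeal hp.ne_top h2
    apply (IsLocalRing.maximalIdeal.isMaximal R).ne_top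
    rw [Ideal.eq_top_iff_one]
    have h4 := sub_mem (Ideal.mul_mem_right a _ hym) h3
    simpa using h4

theorem part2b_17 (hdim : ringKrullDim R = 1) (p : Ideal R) (hp : p ∈ minimalPrimes R)
    (q : Ideal R) (hq : q.IsPrime) (hqp : ¬ q ≤ p)
    (h : MelkerssonCondition R (IsCofiniteWrt R p) q) : False := by
  have hpp : p.IsPrime := hp.1.1
  obtain ⟨y, hyq, hyp⟩ := SetLike.not_le_iff_exists.1 hqp
  have hqm : q ≤ IsLocalRing.maximalIdeal R := IsLocalRing.le_maximalIdeal hq.ne_top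
  obtain ⟨M, hpM, hyM, ⟨u, hu⟩, hne⟩ := exMod17 p hpp y hyp (hqm hyq)
  have hg := good_min17 hdim p hp
  have htop : ∀ m : M, m ∈ Submodule.torsionBySet R M (p : Set R) := fun m =>
    (Submodule.mem_torsionBySet_iff _ _).2 fun a => hpM a a.2 m
  have hcof : IsCofiniteWrt R p M := by
    apply h
    · intro m
      obtain ⟨n, hn⟩ := hyM m
      obtain ⟨k, hk⟩ := le_rad17 q (p ⊔ Ideal.span {y ^ n}) (by
        intro P hP hle
        have h1 : y ∈ P := hP.mem_of_pow_mem n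
          (hle (Ideal.mem_sup_right (Ideal.mem_span_singleton_self _)))
        have h2 : p ≤ P := le_sup_left.trans hle
        rcases min_or_max17 hdim P hP with h' | h'
        · exact absurd (h'.2 hp.1 h2 h1) hyp
        · rw [h']; exact hqm)
      refine ⟨k, fun a ha => ?_⟩
      have : p ⊔ Ideal.span {y ^ n} ≤ Ideal.torsionOf R M m := by
        refine sup_le ?_ ?_
        · intro b hb
          exact (Ideal.mem_torsionOf_iff _ _).2 (hpM b hb m)
        · rw [Ideal.span_singleton_le_iff_mem]
          exact (Ideal.mem_torsionOf_iff _ _).2 hn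
      exact (Ideal.mem_torsionOf_iff _ _).1 (this (hk ha))
    · rw [cof_iff17 p hg]
      constructor
      · intro m
        refine ⟨1, fun a ha => ?_⟩
        rw [pow_one] at ha
        exact Subtype.ext (hpM a ha _)
      · have h1 : Module.Finite R (Submodule.span R {u}) := inferInstance
        have hmem : ∀ m : Submodule.torsionBySet R M (q : Set R), (m : M) ∈ Submodule.span R {u} := by
          intro m
          obtain ⟨a, ha⟩ := hu m ((Submodule.mem_torsionBySet_iff _ _).1 m.2 ⟨y, hyq⟩)
          rw [ha]
          exact Submodule.smul_mem _ _ (Submodule.mem_span_singleton_self u)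
        have h2 : Module.Finite R (Submodule.torsionBySet R M (q : Set R)) := by
          refine Module.Finite.of_injective
            ((Submodule.torsionBySet R M (q : Set R)).subtype.codRestrict _ hmem) ?_
          intro a b hab
          have hab' := congrArg (fun z : Submodule.span R {u} => (z : M)) hab
          exact Subtype.ext hab'
        let T : ModuleCat.{0} R := ModuleCat.of R (Submodule.torsionBySet R M (q : Set R))
        have : Module.Finite R T := h2
        exact (inferInstance : Module.Finite R (Submodule.torsionBySet R T (p : Set R)))
  rw [cof_iff17 p hg] at hcof
  have hfin := hcof.2
  have hfg : (⊤ : Submodule R M).FG := by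
    rw [← Submodule.eq_top_iff'.2 htop]
    exact (Submodule.fg_top _).1 hfin.fg_top
  obtain ⟨S, hS⟩ := hfg
  choose e he using hyM
  obtain ⟨m, hm⟩ := hne (S.sup e)
  apply hm
  have hle : (⊤ : Submodule R M) ≤ Submodule.torsionBy R M (y ^ (S.sup e)) := by
    rw [← hS, Submodule.span_le]
    intro z hz
    rw [SetLike.mem_coe, Submodule.mem_torsionBy_iff]
    have h1 : e z ≤ S.sup e := Finset.le_sup hz
    rw [← Nat.sub_add_cancel h1, pow_add, mul_smul, he, smul_zero]
  exact (Submodule.mem_torsionBy_iff _ _).1 (hle (Submodule.mem_top (x := m)))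

end dim
end D

theorem stmt_17 {R : Type} [CommRing R] [IsNoetherianRing R] [IsLocalRing R]
    (hdim : ringKrullDim R = 1) :
    MP R (IsCofiniteWrt R (IsLocalRing.maximalIdeal R)) = Set.univ ∧
    ∀ p : PrimeSpectrum R, p.asIdeal ∈ minimalPrimes R →
      MP R (IsCofiniteWrt R p.asIdeal) = {p} := by
  refine ⟨?_, ?_⟩
  · rw [Set.eq_univ_iff_forall]
    intro q
    exact part1_17 hdim q.asIdeal (IsLocalRing.le_maximalIdeal q.2.ne_top)
  · intro p hp
    ext q
    rw [Set.mem_singleton_iff]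
    constructor
    · intro h
      by_contra hne
      refine part2b_17 hdim p.asIdeal hp q.asIdeal q.2 ?_ h
      intro hle
      exact hne (PrimeSpectrum.ext (le_antisymm hle (hp.2 ⟨q.2, bot_le⟩ hle)))
    · rintro rfl
      exact part2a_17 q.asIdeal (good_min17 hdim q.asIdeal hp)
end

section
/- Let R be a noetherian local ring with dim R ≥ 1 and p a prime ideal of R with height p = dim R − 1. Then the set of prime ideals of height at least dim R − 1 in MP[S_{A.p-cof}] equals {p}, where S_{A.p-cof} is the Serre subcategory of Artinian p-cofinite R-modules. -/
/-!
Common framework: a *Serre class* is a class of (bundled) `R`-modules closed under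
submodules, quotient modules and extensions.  `MelkerssonCondition R P I` is the
Melkersson condition `(C_I)`: if `Γ_I(M) = M` (every element of `M` is annihilated by
some power of `I`) and `(0 :_M I)` (the `I`-torsion-by-`I` submodule `torsionBySet`)
belongs to the class, then `M` belongs to the class.  `MP R P` is the set of prime
ideals `p` such that the class satisfies `(C_p)`.
-/

open CategoryTheory

variable (R : Type) [CommRing R]

namespace Aux18
variable {R : Type} [CommRing R]

theorem artinian_of_torsionBy {M : Type} [AddCommGroup M] [Module R M] (x : R)
    (ht : ∀ m : M, ∃ n : ℕ, x ^ n • m = 0)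
    (hA : IsArtinian R (Submodule.torsionBy R M x)) : IsArtinian R M := by
  rw [← monotone_stabilizes_iff_artinian]
  intro L
  -- the graded pieces
  let G : ℕ → ℕ → Submodule R (Submodule.torsionBy R M x) := fun k n =>
    ((OrderDual.ofDual (L n)).map (LinearMap.lsmul R M (x ^ k))).comap
      (Submodule.torsionBy R M x).subtype
  have hL : ∀ {a b : ℕ}, a ≤ b → ∀ m : M, m ∈ OrderDual.ofDual (L b) → m ∈ OrderDual.ofDual (L a) :=
    fun h m hm => (L.monotone h : (OrderDual.ofDual (L _)) ≤ (OrderDual.ofDual (L _))) hm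
  have hmem : ∀ k n (t : Submodule.torsionBy R M x),
      t ∈ G k n ↔ ∃ l ∈ (OrderDual.ofDual (L n)), x ^ k • l = (t : M) := by
    intro k n t; rfl
  have hG : ∀ k k' n n', k ≤ k' → n ≤ n' → G k' n' ≤ G k n := by
    intro k k' n n' hk hn t ht
    rw [hmem] at ht ⊢
    obtain ⟨l, hl, h⟩ := ht
    refine ⟨x ^ (k' - k) • l, Submodule.smul_mem _ _ (hL hn _ hl), ?_⟩
    rw [smul_smul, ← pow_add, Nat.add_sub_cancel' hk, h]
  obtain ⟨N0, hN0⟩ := monotone_stabilizes_iff_artinian.mpr hA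
    ⟨fun n => OrderDual.toDual (G n n), fun a b h => hG _ _ _ _ h h⟩
  have hN0' : ∀ m, N0 ≤ m → G N0 N0 = G m m := fun m hm => hN0 m hm
  have hk : ∀ k, ∃ N, ∀ m, N ≤ m → G k N = G k m := fun k => by
    obtain ⟨N, hN⟩ := monotone_stabilizes_iff_artinian.mpr hA
      ⟨fun n => OrderDual.toDual (G k n), fun a b h => hG _ _ _ _ le_rfl h⟩
    exact ⟨N, fun m hm => hN m hm⟩
  choose N hN using hk
  let B := N0 + ∑ k ∈ Finset.range N0, N k
  have hB0 : N0 ≤ B := Nat.le_add_right _ _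
  have hBk : ∀ k < N0, N k ≤ B := fun k hk =>
    le_trans (Finset.single_le_sum (f := N) (fun _ _ => Nat.zero_le _) (Finset.mem_range.2 hk))
      (Nat.le_add_left _ _)
  have hst : ∀ k m, B ≤ m → G k B ≤ G k m := by
    intro k m hm
    by_cases hk : k < N0
    · rw [← hN k B (hBk k hk), ← hN k m ((hBk k hk).trans hm)]
    · push Not at hk
      calc G k B ≤ G N0 N0 := hG _ _ _ _ hk hB0
        _ = G (max k m) (max k m) := hN0' _ (hk.trans (le_max_left _ _))
        _ ≤ G k m := hG _ _ _ _ (le_max_left _ _) (le_max_right _ _)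
  refine ⟨B, fun m hm => le_antisymm (L.monotone hm) ?_⟩
  have key : ∀ k : ℕ, ∀ l ∈ (OrderDual.ofDual (L B)), x ^ k • l = 0 → l ∈ (OrderDual.ofDual (L m)) := by
    intro k
    induction k with
    | zero => intro l _ h; rw [pow_zero, one_smul] at h; rw [h]; exact Submodule.zero_mem _
    | succ k ih =>
      intro l hl h
      have h1 : x ^ k • l ∈ Submodule.torsionBy R M x := by
        rw [Submodule.mem_torsionBy_iff, smul_smul, ← pow_succ', h]
      have h2 : (⟨x ^ k • l, h1⟩ : Submodule.torsionBy R M x) ∈ G k B := (hmem _ _ _).2 ⟨l, hl, rfl⟩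
      obtain ⟨l', hl', h3⟩ := (hmem _ _ _).1 (hst k m hm h2)
      have h4 := ih (l - l') (Submodule.sub_mem _ hl (hL hm _ hl')) (by rw [smul_sub, h3, sub_self])
      simpa using Submodule.add_mem _ h4 hl'
  show (OrderDual.ofDual (L B)) ≤ (OrderDual.ofDual (L m))
  intro l hl
  obtain ⟨n, hn⟩ := ht l
  exact key n l hl hn

theorem artinian_of_torsionBySet_finset (s : Finset R) :
    ∀ (M : Type) [AddCommGroup M] [Module R M],
    (∀ x ∈ s, ∀ m : M, ∃ n : ℕ, x ^ n • m = 0) →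
    IsArtinian R (Submodule.torsionBySet R M (s : Set R)) → IsArtinian R M := by
  classical
  induction s using Finset.induction_on with
  | empty =>
    intro M _ _ _ h
    have : Submodule.torsionBySet R M ((∅ : Finset R) : Set R) = ⊤ := by
      ext; simp [Submodule.mem_torsionBySet_iff]
    rw [this] at h
    exact isArtinian_of_linearEquiv (Submodule.topEquiv (R := R) (M := M))
  | insert a s _ ih =>
    intro M _ _ ht h
    apply artinian_of_torsionBy a (ht a (Finset.mem_insert_self _ _))
    apply ih
    · intro x hx m
      obtain ⟨n, hn⟩ := ht x (Finset.mem_insert_of_mem hx) m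
      exact ⟨n, Subtype.ext hn⟩
    · let f : Submodule.torsionBySet R (Submodule.torsionBy R M a) (s : Set R) →ₗ[R]
          Submodule.torsionBySet R M ((insert a s : Finset R) : Set R) :=
        LinearMap.codRestrict _ ((Submodule.torsionBy R M a).subtype ∘ₗ Submodule.subtype _) (by
          rintro ⟨⟨m, hm⟩, hm2⟩
          rw [Submodule.mem_torsionBySet_iff] at hm2 ⊢
          rintro ⟨b, hb⟩
          rw [Finset.mem_coe, Finset.mem_insert] at hb
          rcases hb with rfl | hb
          · exact hm
          · exact congrArg Subtype.val (hm2 ⟨b, hb⟩))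
      refine isArtinian_of_injective f ?_
      intro u v huv
      have h3 := Subtype.ext_iff.1 huv
      exact Subtype.ext (Subtype.ext h3)

theorem artinian_of_torsionBySet [IsNoetherianRing R] (I : Ideal R)
    (M : Type) [AddCommGroup M] [Module R M]
    (ht : ∀ m : M, ∃ n : ℕ, ∀ x ∈ I ^ n, x • m = 0)
    (h : IsArtinian R (Submodule.torsionBySet R M (I : Set R))) : IsArtinian R M := by
  obtain ⟨s, hs⟩ := (isNoetherianRing_iff_ideal_fg R).1 inferInstance I
  apply artinian_of_torsionBySet_finset s
  · intro x hx m
    obtain ⟨n, hn⟩ := ht m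
    exact ⟨n, hn _ (Ideal.pow_mem_pow (hs ▸ Ideal.subset_span hx) n)⟩
  · rw [← hs] at h
    rw [Submodule.torsionBySet_eq_torsionBySet_span]
    exact h

theorem noeth_of_pow [IsNoetherianRing R] (I : Ideal R) (n : ℕ) :
    ∀ (M : Type) [AddCommGroup M] [Module R M],
    (∀ x ∈ I ^ n, ∀ m : M, x • m = 0) →
    IsNoetherian R (Submodule.torsionBySet R M (I : Set R)) → IsNoetherian R M := by
  obtain ⟨s, hs⟩ := (isNoetherianRing_iff_ideal_fg R).1 inferInstance I
  induction n with
  | zero =>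
    intro M _ _ h _
    have : Subsingleton M := subsingleton_of_forall_eq 0 fun m => by
      simpa using h 1 (by simp) m
    infer_instance
  | succ n ih =>
    intro M _ _ h hT
    let N := Submodule.torsionBySet R M ((I ^ n : Ideal R) : Set R)
    have hN : IsNoetherian R N := by
      apply ih
      · rintro x hx ⟨m, hm⟩
        exact Subtype.ext ((Submodule.mem_torsionBySet_iff _ _).1 hm ⟨x, hx⟩)
      · let f : Submodule.torsionBySet R N (I : Set R) →ₗ[R] Submodule.torsionBySet R M (I : Set R) :=
          LinearMap.codRestrict _ (N.subtype ∘ₗ Submodule.subtype _) (by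
            rintro ⟨⟨m, hm⟩, hm2⟩
            rw [Submodule.mem_torsionBySet_iff] at hm2 ⊢
            exact fun b => congrArg Subtype.val (hm2 b))
        refine isNoetherian_of_injective f ?_
        intro u v huv
        have h3 := Subtype.ext_iff.1 huv
        exact Subtype.ext (Subtype.ext h3)
    let g : M →ₗ[R] (s → N) := LinearMap.pi fun x =>
      LinearMap.codRestrict N (LinearMap.lsmul R M (x : R)) (by
        intro m
        rw [Submodule.mem_torsionBySet_iff]
        rintro ⟨b, hb⟩
        show b • ((x : R) • m) = 0
        rw [smul_smul]
        exact h _ (by rw [pow_succ]; exact Ideal.mul_mem_mul hb (hs ▸ Ideal.subset_span x.2)) m)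
    refine isNoetherian_of_range_eq_ker (Submodule.torsionBySet R M (I : Set R)).subtype g ?_
    have hT2 : Submodule.torsionBySet R M (I : Set R) = Submodule.torsionBySet R M (s : Set R) := by
      rw [Submodule.torsionBySet_eq_torsionBySet_span (s : Set R)]
      exact congrArg (fun J : Ideal R => Submodule.torsionBySet R M (J : Set R)) hs.symm
    rw [Submodule.range_subtype, hT2]
    ext m
    rw [Submodule.mem_torsionBySet_iff, LinearMap.mem_ker]
    constructor
    · intro hm; funext x; exact Subtype.ext (hm x)
    · intro hm x
      exact congrArg Subtype.val (congrFun hm x)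

/-- Artinian, with finitely generated `0 :_M I`. -/
def CC (I : Ideal R) (M : Type) [AddCommGroup M] [Module R M] : Prop :=
  IsArtinian R M ∧ IsNoetherian R (Submodule.torsionBySet R M (I : Set R))

theorem CC.of_injective {I : Ideal R} {M N : Type} [AddCommGroup M] [Module R M]
    [AddCommGroup N] [Module R N] (hN : CC I N) (f : M →ₗ[R] N) (hf : Function.Injective f) :
    CC I M := by
  obtain ⟨_, _⟩ := hN
  refine ⟨isArtinian_of_injective f hf, ?_⟩
  let g : Submodule.torsionBySet R M (I : Set R) →ₗ[R] Submodule.torsionBySet R N (I : Set R) :=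
    LinearMap.codRestrict _ (f ∘ₗ Submodule.subtype _) (by
      rintro ⟨m, hm⟩
      rw [Submodule.mem_torsionBySet_iff] at hm ⊢
      intro b
      show (b : R) • f m = 0
      rw [← map_smul, hm b, map_zero])
  refine isNoetherian_of_injective g ?_
  intro u v huv
  exact Subtype.ext (hf (congrArg Subtype.val huv))

theorem CC.pi {I : Ideal R} {M : Type} [AddCommGroup M] [Module R M] (hM : CC I M)
    (ι : Type) [Finite ι] : CC I (ι → M) := by
  obtain ⟨_, _⟩ := hM
  refine ⟨inferInstance, ?_⟩
  let g : Submodule.torsionBySet R (ι → M) (I : Set R) →ₗ[R]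
      (ι → Submodule.torsionBySet R M (I : Set R)) :=
    LinearMap.pi fun i => LinearMap.codRestrict _ (LinearMap.proj i ∘ₗ Submodule.subtype _) (by
      rintro ⟨m, hm⟩
      rw [Submodule.mem_torsionBySet_iff] at hm ⊢
      intro b
      exact congrFun (hm b) i)
  refine isNoetherian_of_injective g ?_
  intro u v huv
  exact Subtype.ext (funext fun i => congrArg Subtype.val (congrFun huv i))

theorem CC.good [IsNoetherianRing R] {I : Ideal R} {M : Type} [AddCommGroup M] [Module R M]
    (hM : CC I M) (Q : Type) [AddCommGroup Q] [Module R Q] :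
    ∀ (N : Submodule R M) (f : N →ₗ[R] Q),
    (∀ x ∈ I, ∀ n, f (x • n) = 0) → IsNoetherian R (LinearMap.range f) := by
  have := hM.1
  by_contra hbad
  let S : Set (Submodule R M) := {N | ¬ ∀ (f : N →ₗ[R] Q),
    (∀ x ∈ I, ∀ n, f (x • n) = 0) → IsNoetherian R (LinearMap.range f)}
  have hS : S.Nonempty := by
    push Not at hbad
    obtain ⟨N, f, h1, h2⟩ := hbad
    exact ⟨N, fun h => h2 (h f h1)⟩
  obtain ⟨N, hN, hmin⟩ := IsArtinian.set_has_minimal S hS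
  apply hN
  intro f hf
  -- restriction of `f` to a proper submodule of `N` has noetherian range
  have hsub : ∀ A : Submodule R N, A ≠ ⊤ → IsNoetherian R (A.map f) := by
    intro A hA
    have hlt : A.map N.subtype < N := by
      refine lt_of_le_of_ne (Submodule.map_subtype_le N A) fun h => hA ?_
      rw [eq_top_iff]
      intro y _
      have : (y : M) ∈ A.map N.subtype := by rw [h]; exact y.2
      obtain ⟨z, hz, hzy⟩ := this
      rwa [← Subtype.ext hzy]
    have hgood : A.map N.subtype ∉ S := fun h => hmin _ h hlt
    simp only [S, Set.mem_ofPred_eq, not_not] at hgood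
    let j : A.map N.subtype →ₗ[R] N := Submodule.inclusion hlt.le
    have h1 := hgood (f ∘ₗ j) (fun x hx n => by
      rw [LinearMap.comp_apply, map_smul]; exact hf x hx _)
    have h2 : LinearMap.range (f ∘ₗ j) = A.map f := by
      rw [LinearMap.range_comp]
      congr 1
      ext y
      constructor
      · rintro ⟨⟨_, z, hz, rfl⟩, rfl⟩
        exact hz
      · intro hy
        exact ⟨⟨y, y, hy, rfl⟩, rfl⟩
    rwa [h2] at h1
  by_contra hnot
  have hnil : ∀ x ∈ I, ∃ n : ℕ, ∀ y : N, x ^ n • y = 0 := by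
    intro x hx
    let e : Module.End R N := LinearMap.lsmul R N x
    have he : ∀ n y, (e ^ n) y = x ^ n • y := by
      intro n
      induction n with
      | zero => intro y; simp
      | succ n ih => intro y; rw [pow_succ', Module.End.mul_apply, ih, pow_succ', mul_smul]; rfl
    obtain ⟨n, hn⟩ := Filter.eventually_atTop.1 (LinearMap.eventually_codisjoint_ker_pow_range_pow e)
    have hc := (hn (n + 1) (Nat.le_succ n)).eq_top
    by_cases hA : LinearMap.ker (e ^ (n + 1)) = ⊤
    · refine ⟨n + 1, fun y => ?_⟩
      rw [← he]
      exact LinearMap.mem_ker.1 (hA ▸ Submodule.mem_top)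
    · exfalso
      apply hnot
      by_cases hB : LinearMap.range (e ^ (n + 1)) = ⊤
      · have : f = 0 := by
          ext y
          obtain ⟨z, rfl⟩ := LinearMap.range_eq_top.1 hB y
          rw [he, pow_succ', mul_smul, hf x hx]; rfl
        rw [this, LinearMap.range_zero]
        infer_instance
      · have h1 := hsub _ hA
        have h2 := hsub _ hB
        rw [← Submodule.map_top, ← hc, Submodule.map_sup]
        infer_instance
  have hrad : I ≤ (Module.annihilator R N).radical := by
    intro x hx
    obtain ⟨n, hn⟩ := hnil x hx
    exact ⟨n, Module.mem_annihilator.2 hn⟩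
  obtain ⟨k, hk⟩ := Ideal.exists_pow_le_of_le_radical_of_fg hrad
    ((isNoetherianRing_iff_ideal_fg R).1 inferInstance I)
  have : IsNoetherian R N := noeth_of_pow I k N (fun x hx m => Module.mem_annihilator.1 (hk hx) m)
    (hM.of_injective N.subtype N.injective_subtype).2
  exact hnot inferInstance

theorem CC.of_surjective [IsNoetherianRing R] {I : Ideal R} {M Q : Type}
    [AddCommGroup M] [Module R M] [AddCommGroup Q] [Module R Q] (hM : CC I M)
    (g : M →ₗ[R] Q) (hg : Function.Surjective g) : CC I Q := by
  have := hM.1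
  refine ⟨isArtinian_of_surjective M g hg, ?_⟩
  let T := Submodule.torsionBySet R Q (I : Set R)
  have h1 := hM.good Q (T.comap g) (g ∘ₗ Submodule.subtype _) (by
    rintro x hx ⟨n, hn⟩
    show g (x • n) = 0
    rw [map_smul]
    exact (Submodule.mem_torsionBySet_iff _ _).1 hn ⟨x, hx⟩)
  refine isNoetherian_of_le (t := LinearMap.range (g ∘ₗ Submodule.subtype (T.comap g))) ?_
  intro t ht
  obtain ⟨m, rfl⟩ := hg t
  exact ⟨⟨m, ht⟩, rfl⟩

theorem CC.finite_of_killed {I : Ideal R} {M : Type} [AddCommGroup M] [Module R M]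
    (hM : CC I M) (h : ∀ x ∈ I, ∀ m : M, x • m = 0) : IsNoetherian R M := by
  have := hM.2
  refine isNoetherian_of_injective (LinearMap.codRestrict
    (Submodule.torsionBySet R M (I : Set R)) LinearMap.id ?_) ?_
  · intro m
    rw [Submodule.mem_torsionBySet_iff]
    exact fun b => h b b.2 m
  · intro u v huv
    exact congrArg Subtype.val huv

end Aux18

namespace Aux18
variable {R : Type} [CommRing R]

section Res
set_option linter.unusedSectionVars false
variable [IsNoetherianRing R]

/-- A finite free cover. -/
theorem exists_cover (Z : {M : ModuleCat.{0} R // Module.Finite R M}) :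
    ∃ (n : ℕ) (f : (Fin n → R) →ₗ[R] Z.1), Function.Surjective f :=
  have := Z.2
  Module.Finite.exists_fin' R Z.1

noncomputable def rk (Z : {M : ModuleCat.{0} R // Module.Finite R M}) : ℕ := (exists_cover Z).choose
noncomputable def cov (Z : {M : ModuleCat.{0} R // Module.Finite R M}) :
    (Fin (rk Z) → R) →ₗ[R] Z.1 := (exists_cover Z).choose_spec.choose
theorem cov_surj (Z : {M : ModuleCat.{0} R // Module.Finite R M}) : Function.Surjective (cov Z) :=
  (exists_cover Z).choose_spec.choose_spec

noncomputable def syz (Z : {M : ModuleCat.{0} R // Module.Finite R M}) :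
    ℕ → {M : ModuleCat.{0} R // Module.Finite R M}
  | 0 => Z
  | n + 1 => ⟨ModuleCat.of R (LinearMap.ker (cov (syz Z n))),
      inferInstanceAs (Module.Finite R (LinearMap.ker (cov (syz Z n))))⟩

noncomputable def rX (Z : {M : ModuleCat.{0} R // Module.Finite R M}) (n : ℕ) : ModuleCat.{0} R :=
  ModuleCat.of R (Fin (rk (syz Z n)) → R)

noncomputable def rdl (Z : {M : ModuleCat.{0} R // Module.Finite R M}) (n : ℕ) :
    (Fin (rk (syz Z (n + 1))) → R) →ₗ[R] (Fin (rk (syz Z n)) → R) :=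
  (LinearMap.ker (cov (syz Z n))).subtype ∘ₗ
    (cov (syz Z (n + 1)) : _ →ₗ[R] LinearMap.ker (cov (syz Z n)))

theorem range_rdl (Z : {M : ModuleCat.{0} R // Module.Finite R M}) (n : ℕ) :
    LinearMap.range (rdl Z n) = LinearMap.ker (cov (syz Z n)) := by
  ext y
  constructor
  · rintro ⟨u, rfl⟩
    exact (cov (syz Z (n + 1)) u : LinearMap.ker (cov (syz Z n))).2
  · intro hy
    obtain ⟨u, hu⟩ := cov_surj (syz Z (n + 1)) (⟨y, hy⟩ : LinearMap.ker (cov (syz Z n)))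
    refine ⟨u, ?_⟩
    exact congrArg (fun t : LinearMap.ker (cov (syz Z n)) => (t : Fin (rk (syz Z n)) → R)) hu

theorem ker_rdl (Z : {M : ModuleCat.{0} R // Module.Finite R M}) (n : ℕ) :
    LinearMap.ker (rdl Z n) = LinearMap.ker (cov (syz Z (n + 1))) := by
  ext u
  constructor
  · intro h
    exact (Subtype.ext h : (cov (syz Z (n + 1)) u : LinearMap.ker (cov (syz Z n))) = 0)
  · intro h
    exact congrArg (fun t : LinearMap.ker (cov (syz Z n)) => (t : Fin (rk (syz Z n)) → R)) h

noncomputable def rd (Z : {M : ModuleCat.{0} R // Module.Finite R M}) (n : ℕ) :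
    rX Z (n + 1) ⟶ rX Z n := ModuleCat.ofHom (rdl Z n)

theorem rd_comp (Z : {M : ModuleCat.{0} R // Module.Finite R M}) (n : ℕ) :
    rd Z (n + 1) ≫ rd Z n = 0 := by
  apply ModuleCat.hom_ext
  apply LinearMap.range_le_ker_iff.1
  show LinearMap.range (rdl Z (n+1)) ≤ LinearMap.ker (rdl Z n)
  rw [range_rdl, ker_rdl]

noncomputable def rC (Z : {M : ModuleCat.{0} R // Module.Finite R M}) :
    ChainComplex (ModuleCat.{0} R) ℕ := ChainComplex.of (rX Z) (rd Z) (rd_comp Z)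

theorem rC_d (Z : {M : ModuleCat.{0} R // Module.Finite R M}) (n : ℕ) :
    (rC Z).d (n + 1) n = rd Z n := ChainComplex.of_d ..

theorem exact_succ (Z : {M : ModuleCat.{0} R // Module.Finite R M}) (n : ℕ) :
    (rC Z).ExactAt (n + 1) := by
  rw [HomologicalComplex.exactAt_iff' _ (n + 1 + 1) (n + 1) n (by simp) (by simp)]
  rw [ShortComplex.moduleCat_exact_iff_range_eq_ker]
  show LinearMap.range ((rC Z).d (n + 1 + 1) (n + 1)).hom = LinearMap.ker ((rC Z).d (n + 1) n).hom
  rw [rC_d, rC_d]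
  show LinearMap.range (rdl Z (n+1)) = LinearMap.ker (rdl Z n)
  rw [range_rdl, ker_rdl]

noncomputable def aug (Z : {M : ModuleCat.{0} R // Module.Finite R M}) : (rC Z).X 0 ⟶ Z.1 :=
  ModuleCat.ofHom (cov Z)

theorem d_aug (Z : {M : ModuleCat.{0} R // Module.Finite R M}) : (rC Z).d 1 0 ≫ aug Z = 0 := by
  rw [rC_d]
  apply ModuleCat.hom_ext
  apply LinearMap.range_le_ker_iff.1
  show LinearMap.range (rdl Z 0) ≤ LinearMap.ker (cov Z)
  rw [range_rdl]
  exact le_rfl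

theorem exact_aug (Z : {M : ModuleCat.{0} R // Module.Finite R M}) :
    (ShortComplex.mk _ _ (d_aug Z)).Exact := by
  rw [ShortComplex.moduleCat_exact_iff_range_eq_ker]
  show LinearMap.range ((rC Z).d 1 0).hom = LinearMap.ker (cov Z)
  rw [rC_d]
  show LinearMap.range (rdl Z 0) = LinearMap.ker (cov Z)
  rw [range_rdl]
  rfl

noncomputable def res (Z : {M : ModuleCat.{0} R // Module.Finite R M}) :
    ProjectiveResolution Z.1 where
  complex := rC Z
  projective n := by
    show Projective (ModuleCat.of R (Fin (rk (syz Z n)) → R))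
    rw [← IsProjective.iff_projective]
    infer_instance
  π := (ChainComplex.toSingle₀Equiv _ _).symm ⟨aug Z, d_aug Z⟩
  quasiIso := ⟨fun n => by
    cases n with
    | zero =>
      rw [ChainComplex.quasiIsoAt₀_iff, ShortComplex.quasiIso_iff_of_zeros']
      · have he : Epi (aug Z) := (ModuleCat.epi_iff_surjective _).2 (cov_surj Z)
        refine (ShortComplex.exact_and_epi_g_iff_of_iso ?_).2 ⟨exact_aug Z, he⟩
        exact ShortComplex.isoMk (Iso.refl _) (Iso.refl _) (Iso.refl _)
          (by exact (Category.id_comp _).trans (Category.comp_id _).symm) (by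
            refine (Category.id_comp _).trans (Eq.trans ?_ (Category.comp_id _).symm)
            exact (ChainComplex.toSingle₀Equiv_symm_apply_f_zero (aug Z) (d_aug Z)).symm)
      · exact (rC Z).shape 0 0 (by show ¬ (0 + 1 = 0); omega)
      · rfl
      · rfl
    | succ n =>
      rw [quasiIsoAt_iff_exactAt']
      · exact exact_succ Z n
      · apply ChainComplex.exactAt_succ_single_obj⟩

theorem res_finite (Z : {M : ModuleCat.{0} R // Module.Finite R M}) (n : ℕ) :
    Module.Finite R ((res Z).complex.X n) :=
  inferInstanceAs (Module.Finite R (Fin (rk (syz Z n)) → R))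
end Res

/-- The elements of `I` kill `Ext^n(R/I, M)`, computed by a resolution. -/
theorem killed (I : Ideal R) (M : ModuleCat.{0} R)
    (P : ProjectiveResolution (ModuleCat.of R (R ⧸ I))) (n : ℕ) (x : R) (hx : x ∈ I)
    (z : (P.complex.linearYonedaObj R M).homology n) : x • z = 0 := by
  have hc : (x • 𝟙 P.complex) ≫ P.π = 0 := by
    have h0 : P.π ≫ (ChainComplex.single₀ (ModuleCat R)).map (x • 𝟙 (ModuleCat.of R (R ⧸ I)))
        = (x • 𝟙 P.complex) ≫ P.π := by
      apply HomologicalComplex.to_single_hom_ext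
      simp
      exact (Linear.comp_smul _ _ _ _ _ _).trans (congrArg (x • ·) (Category.comp_id _))
    rw [← h0]
    have h1 : x • 𝟙 (ModuleCat.of R (R ⧸ I)) = 0 := by
      apply ModuleCat.hom_ext
      ext
      show x • (1 : R ⧸ I) = 0
      rw [← map_one (Ideal.Quotient.mk I), ← Ideal.Quotient.mk_eq_mk, ← Submodule.Quotient.mk_smul]
      simpa [Ideal.Quotient.eq_zero_iff_mem] using hx
    rw [h1]; simp
  let H := ProjectiveResolution.liftHomotopyZero (x • 𝟙 P.complex) hc
  let K := P.complex.linearYonedaObj R M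
  obtain ⟨c, rfl⟩ := (ModuleCat.epi_iff_surjective (K.homologyπ n)).1 inferInstance z
  let φ : P.complex.X n ⟶ M := K.iCycles n c
  have hφ : ∀ j, P.complex.d j n ≫ φ = 0 := by
    intro j
    have := K.iCycles_d n j
    exact congrArg (fun f => f.hom c) this
  let j := (ComplexShape.down ℕ).next n
  let w : K.X j := (H.hom j n ≫ φ : P.complex.X j ⟶ M)
  have hw : x • c = K.toCycles j n w := by
    apply (ModuleCat.mono_iff_injective (K.iCycles n)).1 inferInstance
    have e1 : K.iCycles n (K.toCycles j n w) = K.d j n w :=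
      congrArg (fun f => f.hom w) (K.toCycles_i j n)
    rw [e1, map_smul]
    show x • φ = P.complex.d n j ≫ H.hom j n ≫ φ
    have e2 := H.comm n
    have e3 : x • φ = (x • 𝟙 P.complex : P.complex ⟶ P.complex).f n ≫ φ := by simp
    rw [e3, e2]
    simp only [HomologicalComplex.zero_f, add_zero, Preadditive.add_comp]
    have e4 : prevD n H.hom ≫ φ = 0 := by
      show (_ ≫ P.complex.d _ n) ≫ φ = 0
      rw [Category.assoc, hφ, Limits.comp_zero]
    rw [e4, add_zero]
    show (_ ≫ _) ≫ φ = _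
    rw [Category.assoc]
  rw [← map_smul, hw]
  exact congrArg (fun f => f.hom w) (K.toCycles_comp_homologyπ j n)

theorem torsion_inj (I : Ideal R) (M : ModuleCat.{0} R)
    (P : ProjectiveResolution (ModuleCat.of R (R ⧸ I))) :
    ∃ f : Submodule.torsionBySet R M (I : Set R) →ₗ[R] (P.complex.linearYonedaObj R M).homology 0,
      Function.Injective f := by
  let K := P.complex.linearYonedaObj R M
  let pi0 : P.complex.X 0 ⟶ ModuleCat.of R (R ⧸ I) := P.π.f 0
  have hpi0 : Function.Surjective pi0 := (ModuleCat.epi_iff_surjective pi0).1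
    (inferInstanceAs (Epi (P.π.f 0)))
  have hd : P.complex.d 1 0 ≫ pi0 = 0 := P.complex_d_comp_π_f_zero
  let T := Submodule.torsionBySet R M (I : Set R)
  let ev : T → ((R ⧸ I) →ₗ[R] M) := fun t => Submodule.liftQ I (LinearMap.toSpanSingleton R M t) (by
    intro x hx
    rw [LinearMap.mem_ker]
    exact (Submodule.mem_torsionBySet_iff _ _).1 t.2 ⟨x, hx⟩)
  have hev1 : ∀ t r, ev t (Submodule.Quotient.mk r) = r • (t : M) := fun t r => rfl
  let kl : T →ₗ[R] (P.complex.X 0 ⟶ M) :=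
    { toFun := fun t => pi0 ≫ ModuleCat.ofHom (ev t)
      map_add' := by
        intro a b
        rw [← Preadditive.comp_add]
        congr 1
        apply ModuleCat.hom_ext
        ext
        show (1 : R) • ((a + b : T) : M) = (1 : R) • (a : M) + (1 : R) • (b : M)
        simp
      map_smul' := by
        intro r a
        rw [RingHom.id_apply, ← Linear.comp_smul]
        congr 1
        apply ModuleCat.hom_ext
        ext
        show (1 : R) • ((r • a : T) : M) = r • (1 : R) • (a : M)
        simp }
  have hkl : Function.Injective kl := by
    intro a b hab
    have h1 : pi0 ≫ ModuleCat.ofHom (ev a) = pi0 ≫ ModuleCat.ofHom (ev b) := hab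
    obtain ⟨u, hu⟩ := hpi0 (Submodule.Quotient.mk (1 : R) : R ⧸ I)
    have h2 : ev a (pi0 u) = ev b (pi0 u) := congrArg (fun f => f.hom u) h1
    have h3 : ∀ c : T, ev c (pi0 u) = c := by
      intro c
      rw [hu]
      exact (hev1 c 1).trans (one_smul _ _)
    rw [h3, h3] at h2
    exact Subtype.ext h2
  let k : ModuleCat.of R T ⟶ K.X 0 := ModuleCat.ofHom kl
  have hk : k ≫ K.d 0 1 = 0 := by
    apply ModuleCat.hom_ext
    apply LinearMap.ext
    intro t
    show P.complex.d 1 0 ≫ pi0 ≫ ModuleCat.ofHom (ev t) = 0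
    rw [← Category.assoc, hd, Limits.zero_comp]
  let l := K.liftCycles k 1 (by simp) hk
  have hl : Function.Injective l := by
    intro a b hab
    apply hkl
    have e : l ≫ K.iCycles 0 = k := K.liftCycles_i k 1 (by simp) hk
    show k a = k b
    rw [← e]
    show K.iCycles 0 (l a) = K.iCycles 0 (l b)
    rw [hab]
  let i0 := CochainComplex.isoHomologyπ₀ K
  refine ⟨(l ≫ i0.hom).hom, ?_⟩
  intro a b hab
  apply hl
  exact (ModuleCat.mono_iff_injective i0.hom).1 inferInstance hab

end Aux18

namespace Aux18

theorem CC.hom {R : Type} [CommRing R] {I : Ideal R} {M : ModuleCat.{0} R} (hM : CC I M)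
    (X : ModuleCat.{0} R) [Module.Finite R X] : CC I (X ⟶ M) := by
  obtain ⟨n, f, hf⟩ := Module.Finite.exists_fin' R X
  let g : (X ⟶ M) →ₗ[R] (Fin n → M) :=
    { toFun := fun φ i => φ (f (Pi.single i 1))
      map_add' := fun _ _ => rfl
      map_smul' := fun _ _ => rfl }
  refine (hM.pi (Fin n)).of_injective g ?_
  intro φ ψ h
  apply ModuleCat.hom_ext
  have h2 : φ.hom ∘ₗ f = ψ.hom ∘ₗ f := by
    apply LinearMap.pi_ext'
    intro i
    apply LinearMap.ext_ring
    exact congrFun h i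
  apply LinearMap.ext
  intro x
  obtain ⟨u, rfl⟩ := hf x
  exact LinearMap.congr_fun h2 u

theorem CC.ext_finite {R : Type} [CommRing R] [IsNoetherianRing R] {I : Ideal R}
    {M : ModuleCat.{0} R} (hM : CC I M) (i : ℕ) : Module.Finite R
    (((Ext R (ModuleCat.{0} R) i).obj (Opposite.op (ModuleCat.of R (R ⧸ I)))).obj M) := by
  let Z : {M : ModuleCat.{0} R // Module.Finite R M} :=
    ⟨ModuleCat.of R (R ⧸ I), inferInstanceAs (Module.Finite R (R ⧸ I))⟩
  let P : ProjectiveResolution (ModuleCat.of R (R ⧸ I)) := res Z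
  let K := P.complex.linearYonedaObj R M
  have hX : CC I (K.X i) := by
    have := res_finite Z i
    exact hM.hom ((res Z).complex.X i)
  have hC : CC I (K.cycles i) := hX.of_injective (K.iCycles i).hom
    ((ModuleCat.mono_iff_injective (K.iCycles i)).1 inferInstance)
  have hH : CC I (K.homology i) := hC.of_surjective (K.homologyπ i).hom
    ((ModuleCat.epi_iff_surjective (K.homologyπ i)).1 inferInstance)
  have hN : IsNoetherian R (K.homology i) := hH.finite_of_killed fun x hx z => killed I M P i x hx z
  exact Module.Finite.equiv (P.isoExt (R := R) i M).toLinearEquiv.symm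

theorem torsion_finite {R : Type} [CommRing R] [IsNoetherianRing R] {I : Ideal R}
    {M : ModuleCat.{0} R} (h : Module.Finite R
    (((Ext R (ModuleCat.{0} R) 0).obj (Opposite.op (ModuleCat.of R (R ⧸ I)))).obj M)) :
    IsNoetherian R (Submodule.torsionBySet R M (I : Set R)) := by
  let P := ProjectiveResolution.of (ModuleCat.of R (R ⧸ I))
  have h1 := Module.Finite.equiv (P.isoExt (R := R) 0 M).toLinearEquiv
  obtain ⟨f, hf⟩ := torsion_inj I M P
  exact isNoetherian_of_injective f hf

theorem support_sub {R : Type} [CommRing R] (I : Ideal R)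
    (M : ModuleCat.{0} R) (ht : ∀ m : M, ∃ n : ℕ, ∀ x ∈ I ^ n, x • m = 0) :
    Module.support R M ⊆ PrimeSpectrum.zeroLocus (I : Set R) := by
  intro P hP
  rw [Module.mem_support_iff_exists_annihilator] at hP
  obtain ⟨m, hm⟩ := hP
  rw [PrimeSpectrum.mem_zeroLocus]
  obtain ⟨n, hn⟩ := ht m
  have h1 : I ^ n ≤ P.asIdeal := by
    refine le_trans ?_ hm
    intro x hx
    rw [Submodule.mem_annihilator_span_singleton]
    exact hn x hx
  exact Ideal.IsPrime.le_of_pow_le h1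

theorem mem_p {R : Type} [CommRing R] [IsNoetherianRing R] (p : PrimeSpectrum R) :
    p ∈ MP R (fun M : ModuleCat.{0} R => IsArtinian R M ∧ IsCofiniteWrt R p.asIdeal M) := by
  intro M ht ⟨hA, hC⟩
  have hM : IsArtinian R M := artinian_of_torsionBySet p.asIdeal M ht hA
  let T := Submodule.torsionBySet R M (p.asIdeal : Set R)
  have h1 : IsNoetherian R (Submodule.torsionBySet R T (p.asIdeal : Set R)) :=
    torsion_finite (M := ModuleCat.of R T) (hC.2 0)
  have h2 : IsNoetherian R T := by
    refine CC.finite_of_killed (I := p.asIdeal) ⟨hA, h1⟩ ?_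
    rintro x hx ⟨m, hm⟩
    exact Subtype.ext ((Submodule.mem_torsionBySet_iff _ _).1 hm ⟨x, hx⟩)
  exact ⟨hM, support_sub _ _ ht, fun i => CC.ext_finite ⟨hM, h2⟩ i⟩

theorem artinian_of_killed {R : Type} [CommRing R] [IsNoetherianRing R] [IsLocalRing R]
    (W : Type) [AddCommGroup W] [Module R W] [Module.Finite R W] (N : ℕ)
    (h : ∀ x ∈ IsLocalRing.maximalIdeal R ^ N, ∀ w : W, x • w = 0) : IsArtinian R W := by
  apply artinian_of_torsionBySet (IsLocalRing.maximalIdeal R) W (fun w => ⟨N, fun x hx => h x hx w⟩)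
  let m := IsLocalRing.maximalIdeal R
  let V := Submodule.torsionBySet R W (m : Set R)
  have hV : Module.IsTorsionBySet R V (m : Set R) := Submodule.torsionBySet_isTorsionBySet _
  letI : Module (R ⧸ m) V := hV.module
  letI : Field (R ⧸ m) := Ideal.Quotient.field m
  haveI : IsScalarTower R (R ⧸ m) V := hV.isScalarTower
  have : Module.Finite R V := inferInstance
  have : Module.Finite (R ⧸ m) V := Module.Finite.of_restrictScalars_finite R (R ⧸ m) V
  have : IsArtinian (R ⧸ m) V := inferInstance
  exact (isArtinian_of_surjective_algebraMap (S := R) (R := R ⧸ m) (M := V)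
    Ideal.Quotient.mk_surjective)

theorem not_mem_of {R : Type} [CommRing R] [IsNoetherianRing R] [IsLocalRing R]
    (p q : PrimeSpectrum R)
    (hb : ∀ b ∉ p.asIdeal, ∃ N, IsLocalRing.maximalIdeal R ^ N ≤ p.asIdeal ⊔ Ideal.span {b})
    (y : R) (hyq : y ∈ q.asIdeal) (hyp : y ∉ p.asIdeal) :
    q ∉ MP R (fun M : ModuleCat.{0} R => IsArtinian R M ∧ IsCofiniteWrt R p.asIdeal M) := by
  intro hq
  let A := R ⧸ p.asIdeal
  let K := FractionRing A
  let N : Submodule R K := LinearMap.range (IsScalarTower.toAlgHom R A K).toLinearMap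
  have hN : ∀ a : A, algebraMap A K a ∈ N := fun a => ⟨a, rfl⟩
  let M := K ⧸ N
  have hqm : q.asIdeal ≤ IsLocalRing.maximalIdeal R := IsLocalRing.le_maximalIdeal q.2.ne_top
  have hsm : ∀ (x : R) (k : K), x • k = algebraMap A K (Ideal.Quotient.mk _ x) * k := by
    intro x k
    rw [Algebra.smul_def]
    rfl
  have hy0 : algebraMap A K (Ideal.Quotient.mk _ y) ≠ 0 := by
    intro h
    rw [map_eq_zero_iff _ (IsFractionRing.injective A K)] at h
    exact hyp (Ideal.Quotient.eq_zero_iff_mem.1 h)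
  have hkp : ∀ x ∈ p.asIdeal, ∀ m : M, x • m = 0 := by
    intro x hx m
    obtain ⟨k, rfl⟩ := Submodule.Quotient.mk_surjective _ m
    rw [← Submodule.Quotient.mk_smul, hsm, Ideal.Quotient.eq_zero_iff_mem.2 hx, map_zero, zero_mul,
      Submodule.Quotient.mk_zero]
  have htor : ∀ m : M, ∃ n : ℕ, ∀ x ∈ q.asIdeal ^ n, x • m = 0 := by
    intro m
    obtain ⟨k, rfl⟩ := Submodule.Quotient.mk_surjective _ m
    obtain ⟨a, b, hbne, rfl⟩ := IsFractionRing.div_surjective (A := A) k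
    obtain ⟨b, rfl⟩ := Ideal.Quotient.mk_surjective b
    have hb0 : (Ideal.Quotient.mk p.asIdeal b) ≠ 0 := nonZeroDivisors.ne_zero hbne
    obtain ⟨n, hn⟩ := hb b (fun h => hb0 (Ideal.Quotient.eq_zero_iff_mem.2 h))
    refine ⟨n, fun x hx => ?_⟩
    obtain ⟨u, hu, v, hv, rfl⟩ := Submodule.mem_sup.1 (hn (Ideal.pow_right_mono hqm n hx))
    obtain ⟨c, rfl⟩ := Ideal.mem_span_singleton'.1 hv
    rw [add_smul, hkp u hu, zero_add, ← Submodule.Quotient.mk_smul, Submodule.Quotient.mk_eq_zero,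
      hsm]
    have hb1 : algebraMap A K (Ideal.Quotient.mk _ b) ≠ 0 := by
      rwa [Ne, map_eq_zero_iff _ (IsFractionRing.injective A K)]
    convert hN (Ideal.Quotient.mk _ c * a) using 1
    rw [map_mul, map_mul, map_mul, mul_assoc, mul_div_assoc']
    rw [mul_div_cancel_left₀ _ hb1]
  let T := Submodule.torsionBySet R M (q.asIdeal : Set R)
  have hTn : IsNoetherian R T := by
    let g : A →ₗ[R] M := N.mkQ ∘ₗ
      (LinearMap.mulLeft R ((algebraMap A K (Ideal.Quotient.mk _ y))⁻¹)) ∘ₗ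
        (IsScalarTower.toAlgHom R A K).toLinearMap
    have hle : T ≤ LinearMap.range g := by
      intro t ht
      have h1 := (Submodule.mem_torsionBySet_iff _ _).1 ht ⟨y, hyq⟩
      obtain ⟨k, rfl⟩ := Submodule.Quotient.mk_surjective _ t
      have h2 : y • k ∈ N := by
        rw [← Submodule.Quotient.mk_eq_zero, Submodule.Quotient.mk_smul]; exact h1
      obtain ⟨a, ha⟩ := h2
      have ha' : algebraMap A K a = algebraMap A K (Ideal.Quotient.mk _ y) * k := by
        rw [← hsm]; exact ha
      refine ⟨a, ?_⟩
      show N.mkQ ((algebraMap A K (Ideal.Quotient.mk _ y))⁻¹ * algebraMap A K a) = N.mkQ k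
      rw [ha', inv_mul_cancel_left₀ hy0]
    exact isNoetherian_of_le hle
  have hTA : IsArtinian R T := by
    obtain ⟨n, hn⟩ := hb y hyp
    refine artinian_of_killed T n ?_
    rintro x hx ⟨w, hw⟩
    obtain ⟨u, hu, v, hv, rfl⟩ := Submodule.mem_sup.1 (hn hx)
    obtain ⟨c, rfl⟩ := Ideal.mem_span_singleton'.1 hv
    apply Subtype.ext
    show (u + c * y) • w = 0
    rw [add_smul, hkp u hu, zero_add, mul_smul]
    have h1 : y • w = 0 := (Submodule.mem_torsionBySet_iff _ _).1 hw ⟨y, hyq⟩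
    rw [h1, smul_zero]
  have hTC : CC p.asIdeal T := ⟨hTA, inferInstance⟩
  obtain ⟨-, -, hfin⟩ := hq (ModuleCat.of R M) htor ⟨hTA, support_sub _ (ModuleCat.of R T)
    (fun m => ⟨1, fun x hx => Subtype.ext (hkp x (by simpa using hx) m)⟩),
    fun i => CC.ext_finite (M := ModuleCat.of R T) hTC i⟩
  have h1 : IsNoetherian R (Submodule.torsionBySet R M (p.asIdeal : Set R)) :=
    torsion_finite (M := ModuleCat.of R M) (hfin 0)
  have htop : Submodule.torsionBySet R M (p.asIdeal : Set R) = ⊤ := by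
    rw [eq_top_iff]
    intro m _
    rw [Submodule.mem_torsionBySet_iff]
    exact fun x => hkp x x.2 m
  rw [htop] at h1
  have hfg : (⊤ : Submodule R M).FG := by
    have : Module.Finite R (⊤ : Submodule R M) := inferInstance
    exact Module.Finite.iff_fg.1 this
  have hbot : (⊤ : Submodule R M) = ⊥ := by
    apply Submodule.eq_bot_of_le_smul_of_le_jacobson_bot (IsLocalRing.maximalIdeal R) _ hfg
    · intro m _
      obtain ⟨k, rfl⟩ := Submodule.Quotient.mk_surjective _ m
      have h2 : k = y • ((algebraMap A K (Ideal.Quotient.mk _ y))⁻¹ * k) := by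
        rw [hsm, mul_inv_cancel_left₀ hy0]
      rw [h2, Submodule.Quotient.mk_smul]
      exact Submodule.smul_mem_smul (hqm hyq) Submodule.mem_top
    · exact IsLocalRing.maximalIdeal_le_jacobson _
  have h3 : (Submodule.Quotient.mk ((algebraMap A K (Ideal.Quotient.mk _ y))⁻¹) : M) = 0 := by
    have : (Submodule.Quotient.mk ((algebraMap A K (Ideal.Quotient.mk _ y))⁻¹) : M)
      ∈ (⊤ : Submodule R M) := Submodule.mem_top
    rw [hbot] at this
    exact (Submodule.mem_bot R).1 this
  rw [Submodule.Quotient.mk_eq_zero] at h3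
  obtain ⟨a, ha⟩ := h3
  obtain ⟨a, rfl⟩ := Ideal.Quotient.mk_surjective a
  have ha' : algebraMap A K (Ideal.Quotient.mk _ a) = (algebraMap A K (Ideal.Quotient.mk _ y))⁻¹ := ha
  have h4 : (Ideal.Quotient.mk p.asIdeal (y * a)) = Ideal.Quotient.mk p.asIdeal 1 := by
    apply IsFractionRing.injective A K
    rw [map_mul, map_mul, ha', mul_inv_cancel₀ hy0, map_one, map_one]
  have h5 := IsLocalRing.le_maximalIdeal p.2.ne_top (Ideal.Quotient.eq.1 h4)
  have h6 : (1 : R) ∈ IsLocalRing.maximalIdeal R := by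
    have := Ideal.sub_mem _ (Ideal.mul_mem_right a _ (hqm hyq)) h5
    simpa using this
  exact (IsLocalRing.maximalIdeal.isMaximal R).ne_top ((Ideal.eq_top_iff_one _).2 h6)

end Aux18

/-- Over a noetherian local ring with `dim R ≥ 1` and a prime `p` of height
`dim R - 1`, the primes of height at least `dim R - 1` in `MP[S_{A.p-cof}]`
(Artinian `p`-cofinite modules) form exactly `{p}`. -/
theorem stmt_18 {R : Type} [CommRing R] [IsNoetherianRing R] [IsLocalRing R]
    (hdim : 1 ≤ ringKrullDim R) (p : PrimeSpectrum R)
    (hp : (Order.height p : WithBot ℕ∞) + 1 = ringKrullDim R) :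
    {q : PrimeSpectrum R | (Order.height q : WithBot ℕ∞) + 1 ≥ ringKrullDim R ∧
        q ∈ MP R (fun M : ModuleCat.{0} R => IsArtinian R M ∧ IsCofiniteWrt R p.asIdeal M)}
      = {p} := by
  obtain ⟨d, hd⟩ : ∃ d : ℕ, Order.height p = d := by
    have h1 : (Order.height p : WithBot ℕ∞) ≤ ringKrullDim R := Order.height_le_krullDim p
    have h2 : ringKrullDim R < ⊤ := ringKrullDim_lt_top
    have h3 : Order.height p < ⊤ := by
      have := lt_of_le_of_lt h1 h2
      exact WithBot.coe_lt_coe.1 this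
    exact ⟨_, (ENat.natCast_toNat h3.ne).symm⟩
  -- all heights are at most `d + 1`
  have hle : ∀ P : PrimeSpectrum R, Order.height P ≤ (d : ℕ∞) + 1 := by
    intro P
    have h1 : (Order.height P : WithBot ℕ∞) ≤ ringKrullDim R := Order.height_le_krullDim P
    rw [← hp, hd] at h1
    exact_mod_cast h1
  have hmax : ∀ P : PrimeSpectrum R, p < P → P.asIdeal = IsLocalRing.maximalIdeal R := by
    intro P hP
    by_contra hne
    have h1 : P < IsLocalRing.closedPoint R := by
      refine lt_of_le_of_ne (IsLocalRing.le_maximalIdeal P.2.ne_top) fun h => hne ?_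
      rw [h]; rfl
    have h2 := Order.height_add_one_le hP
    have h3 := Order.height_add_one_le h1
    have h4 := hle (IsLocalRing.closedPoint R)
    rw [hd] at h2
    have h5 : (d : ℕ∞) + 1 + 1 ≤ d + 1 := (add_le_add_left h2 1).trans (h3.trans h4)
    have h6 : d + 1 + 1 ≤ d + 1 := by exact_mod_cast h5
    omega
  ext q
  constructor
  · rintro ⟨hq, hmem⟩
    by_contra hne
    have hne' : q ≠ p := hne
    rw [← hp, hd] at hq
    have hnle : ¬ q.asIdeal ≤ p.asIdeal := by
      intro h
      have hlt : q < p := lt_of_le_of_ne h hne'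
      have h1 := Order.height_add_one_le hlt
      rw [hd] at h1
      have h2 : (d : ℕ∞) + 1 ≤ Order.height q + 1 := by exact_mod_cast hq
      have h3 : d + 1 ≤ d := by exact_mod_cast h2.trans h1
      omega
    obtain ⟨y, hyq, hyp⟩ := Set.not_subset.1 hnle
    refine Aux18.not_mem_of p q ?_ y hyq hyp hmem
    intro b hb
    apply Ideal.exists_pow_le_of_le_radical_of_fg _
      ((isNoetherianRing_iff_ideal_fg R).1 inferInstance _)
    rw [Ideal.radical_eq_sInf]
    refine le_sInf ?_
    rintro J ⟨hJ, hJp⟩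
    have hlt : p < (⟨J, hJp⟩ : PrimeSpectrum R) := by
      refine lt_of_le_of_ne (le_sup_left.trans hJ : p.asIdeal ≤ J) fun h => hb ?_
      rw [h]
      exact hJ (Ideal.mem_sup_right (Ideal.mem_span_singleton_self b))
    exact (hmax _ hlt).ge
  · rintro rfl
    exact ⟨hp.ge, Aux18.mem_p q⟩
end

section
/- Let R be a noetherian local ring with a unique minimal prime ideal q. (1) If dim R = 2, then for each Serre subcategory S of the category of R-modules, MP[S] has one of the following forms: (a) MP[S] = {q} ∪ W for some specialization closed subset W of Spec(R), or (b) MP[S] = {q} ∪ {p} for some prime ideal p of R with height p = 1. (2) Conversely, if MP[S] has only these two forms for every Serre subcategory S, then dim R ≤ 2. -/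
/-!
Common framework: a *Serre class* is a class of (bundled) `R`-modules closed under
submodules, quotient modules and extensions.  `MelkerssonCondition R P I` is the
Melkersson condition `(C_I)`: if `Γ_I(M) = M` (every element of `M` is annihilated by
some power of `I`) and `(0 :_M I)` (the `I`-torsion-by-`I` submodule `torsionBySet`)
belongs to the class, then `M` belongs to the class.  `MP R P` is the set of prime
ideals `p` such that the class satisfies `(C_p)`.
-/

open CategoryTheory

variable (R : Type) [CommRing R]

namespace Mel

theorem restr_inj {R : Type} [CommRing R] {X Y : Type} [AddCommGroup X] [Module R X]
    [AddCommGroup Y] [Module R Y] (f : X →ₗ[R] Y) (hf : Function.Injective f)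
    {p : Submodule R X} {q : Submodule R Y} (h : ∀ x ∈ p, f x ∈ q) :
    Function.Injective (f.restrict h) := fun _ _ hab =>
  Subtype.ext (hf (congrArg (fun z : q => (z : Y)) hab))

section serre
variable {R : Type} [CommRing R] (S : SerreClass R)
  {X Y Z : Type} [AddCommGroup X] [Module R X] [AddCommGroup Y] [Module R Y]
  [AddCommGroup Z] [Module R Z]

/-- Membership of an unbundled module. -/
def Mem (X : Type) [AddCommGroup X] [Module R X] : Prop := S.mem (ModuleCat.of R X)

theorem Mem.inj {S : SerreClass R} (h : Mem S Y) (f : X →ₗ[R] Y) (hf : Function.Injective f) :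
    Mem S X :=
  S.mem_of_injective (M := ModuleCat.of R X) (N := ModuleCat.of R Y) f hf h

theorem Mem.surj {S : SerreClass R} (h : Mem S X) (f : X →ₗ[R] Y) (hf : Function.Surjective f) :
    Mem S Y :=
  S.mem_of_surjective (M := ModuleCat.of R X) (N := ModuleCat.of R Y) f hf h

theorem Mem.ext {S : SerreClass R} (hX : Mem S X) (hZ : Mem S Z) (f : X →ₗ[R] Y) (g : Y →ₗ[R] Z)
    (hf : Function.Injective f) (hg : Function.Surjective g)
    (h : LinearMap.range f = LinearMap.ker g) :
    Mem S Y :=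
  S.mem_of_extension (A := ModuleCat.of R X) (M := ModuleCat.of R Y) (B := ModuleCat.of R Z)
    f g hf hg h hX hZ

/-- If the kernel and the target of a map are in the class, so is the source. -/
theorem Mem.ker_tgt {S : SerreClass R} (f : Y →ₗ[R] Z) (hK : Mem S (LinearMap.ker f))
    (hZ : Mem S Z) : Mem S Y := by
  have hr : Mem S (LinearMap.range f) := hZ.inj (LinearMap.range f).subtype Subtype.val_injective
  refine Mem.ext hK hr (LinearMap.ker f).subtype f.rangeRestrict Subtype.val_injective
    f.surjective_rangeRestrict ?_
  simp

theorem Mem.prod {S : SerreClass R} (hY : Mem S Y) (hZ : Mem S Z) : Mem S (Y × Z) := by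
  refine Mem.ext hY hZ (LinearMap.inl R Y Z) (LinearMap.snd R Y Z) LinearMap.inl_injective
    LinearMap.snd_surjective ?_
  exact LinearMap.range_inl R Y Z

/-- If `s` is finite, `W` is a submodule in `S` with `x • y ∈ W`, then the whole module is in `S`
as soon as `0 : s` is. -/
theorem Mem.of_finset {S : SerreClass R} (s : Finset R) :
    ∀ (Y : Type) [AddCommGroup Y] [Module R Y] (Z : Type) [AddCommGroup Z] [Module R Z]
    (j : Z →ₗ[R] Y) (_ : Function.Injective j) (_ : Mem S Z)
    (_ : ∀ x ∈ s, ∀ y : Y, x • y ∈ LinearMap.range j)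
    (_ : Mem S (Submodule.torsionBySet R Y (s : Set R))), Mem S Y := by
  classical
  induction s using Finset.induction_on with
  | empty =>
    intro Y _ _ Z _ _ j hj hZ hs h
    have : Submodule.torsionBySet R Y ((∅ : Finset R) : Set R) = ⊤ := by
      ext; simp [Submodule.mem_torsionBySet_iff]
    rw [this] at h
    exact h.inj (Submodule.topEquiv.symm : Y ≃ₗ[R] _).toLinearMap
      (Submodule.topEquiv.symm : Y ≃ₗ[R] _).injective
  | insert x s hx ih =>
    intro Y _ _ Z _ _ j hj hZ hs h
    -- first the kernel of `x`
    let f : Y →ₗ[R] LinearMap.range j :=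
      (LinearMap.lsmul R Y x).codRestrict _ (fun y => hs x (by simp) y)
    have hr : Mem S (LinearMap.range j) := hZ.surj j.rangeRestrict j.surjective_rangeRestrict
    refine Mem.ker_tgt f ?_ hr
    let K := LinearMap.ker f
    have hKx : ∀ k : K, x • (k : Y) = 0 := by
      intro k
      have := k.2
      rw [LinearMap.mem_ker] at this
      exact congrArg (fun z : LinearMap.range j => (z : Y)) this
    refine ih K ((LinearMap.range j).comap K.subtype)
      ((LinearMap.range j).comap K.subtype).subtype Subtype.val_injective ?_ ?_ ?_
    · refine hr.inj ((K.subtype).restrict (p := (LinearMap.range j).comap K.subtype)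
        (q := LinearMap.range j) (fun y hy => hy)) ?_
      exact restr_inj _ Subtype.val_injective _
    · intro a ha y
      simpa using hs a (by simp [ha]) y
    · refine h.inj ((K.subtype).restrict (p := Submodule.torsionBySet R K (s : Set R))
        (q := Submodule.torsionBySet R Y ((insert x s : Finset R) : Set R)) ?_) ?_
      · intro y hy
        rw [Submodule.mem_torsionBySet_iff] at hy ⊢
        rintro ⟨a, ha⟩
        rcases Finset.mem_insert.1 (Finset.mem_coe.1 ha) with rfl | ha
        · exact hKx y
        · exact congrArg Subtype.val (hy ⟨a, ha⟩)
      · exact restr_inj _ Subtype.val_injective _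

theorem Mem.sub {S : SerreClass R} {A B : Submodule R X} (h : Mem S B) (hAB : A ≤ B) : Mem S A :=
  h.inj (Submodule.inclusion hAB) (Submodule.inclusion_injective hAB)

theorem Mem.pow {S : SerreClass R} {I : Ideal R} (hI : I.FG)
    (h : Mem S (Submodule.torsionBySet R X (I : Set R))) (n : ℕ) :
    Mem S (Submodule.torsionBySet R X ((I ^ n : Ideal R) : Set R)) := by
  induction n with
  | zero =>
    refine h.sub ?_
    intro y hy
    rw [Submodule.mem_torsionBySet_iff] at hy ⊢
    have := hy ⟨1, by simp⟩
    simp at this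
    simp [this]
  | succ n ih =>
    obtain ⟨s, rfl⟩ := hI
    have hle : Submodule.torsionBySet R X ((Submodule.span R (s : Set R) ^ n : Ideal R) : Set R) ≤
      Submodule.torsionBySet R X ((Submodule.span R (s : Set R) ^ (n+1) : Ideal R) : Set R) :=
      Submodule.torsionBySet_le_torsionBySet_pow _ _ (Nat.le_succ n) _
    refine Mem.of_finset s _ _ (Submodule.inclusion hle) (Submodule.inclusion_injective hle) ih
      ?_ ?_
    · intro x hx y
      rw [Submodule.range_inclusion]
      have hy := y.2
      simp only [Submodule.mem_comap, Submodule.subtype_apply]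
      rw [Submodule.mem_torsionBySet_iff] at hy ⊢
      rintro ⟨a, ha⟩
      have := hy ⟨a * x, by
        rw [pow_succ]
        exact Ideal.mul_mem_mul ha (Submodule.subset_span hx)⟩
      simpa [mul_smul] using this
    · have e : Submodule.torsionBySet R X ((Submodule.span R (s : Set R) : Ideal R) : Set R) =
        Submodule.torsionBySet R X (s : Set R) :=
        (Submodule.torsionBySet_eq_torsionBySet_span _).symm
      rw [e] at h
      refine h.inj ((Submodule.subtype _).restrict (p := Submodule.torsionBySet R _ (s : Set R))
        (q := Submodule.torsionBySet R X (s : Set R)) ?_) ?_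
      · intro y hy
        rw [Submodule.mem_torsionBySet_iff] at hy ⊢
        intro a
        exact congrArg Subtype.val (hy a)
      · exact restr_inj _ Subtype.val_injective _

/-- `(C_I)` and `(C_J)` imply `(C_{I+J})`. -/
theorem mel_sup {I J : Ideal R} (hI : MelkerssonCondition R S.mem I)
    (hJ : MelkerssonCondition R S.mem J) : MelkerssonCondition R S.mem (I ⊔ J) := by
  intro M hM h
  refine hI M (fun m => ?_) ?_
  · obtain ⟨n, hn⟩ := hM m
    exact ⟨n, fun x hx => hn x (Ideal.pow_right_mono le_sup_left n hx)⟩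
  · refine hJ (ModuleCat.of R (Submodule.torsionBySet R M (I : Set R))) (fun m => ?_) ?_
    · obtain ⟨n, hn⟩ := hM m.1
      exact ⟨n, fun x hx => Subtype.ext (hn x (Ideal.pow_right_mono le_sup_right n hx))⟩
    · refine Mem.inj (S := S) h ((Submodule.subtype _).restrict
        (p := Submodule.torsionBySet R (Submodule.torsionBySet R M (I : Set R)) (J : Set R))
        (q := Submodule.torsionBySet R M ((I ⊔ J : Ideal R) : Set R)) ?_) ?_
      · intro y hy
        have hy1 := y.2
        rw [Submodule.mem_torsionBySet_iff] at hy hy1 ⊢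
        rintro ⟨a, ha⟩
        obtain ⟨b, hb, c, hc, rfl⟩ := Submodule.mem_sup.1 ha
        have h1 : b • (y : M) = 0 := hy1 ⟨b, hb⟩
        have h2 : c • (y : M) = 0 := congrArg Subtype.val (hy ⟨c, hc⟩)
        change (b + c) • (y : M) = 0
        rw [add_smul, h1, h2, add_zero]
      · exact restr_inj _ Subtype.val_injective _

theorem mel_of_pow_le {I m : Ideal R} (hm : m.FG) (hIm : I ≤ m) {n : ℕ} (hn : m ^ n ≤ I)
    (hI : MelkerssonCondition R S.mem I) : MelkerssonCondition R S.mem m := by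
  intro M hM h
  refine hI M (fun y => ?_) ?_
  · obtain ⟨k, hk⟩ := hM y
    exact ⟨k, fun x hx => hk x (Ideal.pow_right_mono hIm k hx)⟩
  · exact (Mem.pow (S := S) hm h n).sub (Submodule.torsionBySet_le_torsionBySet_of_subset hn)

theorem mel_nil {I : Ideal R} (hm : I.FG) {n : ℕ} (hn : I ^ n ≤ ⊥) :
    MelkerssonCondition R S.mem I := by
  refine mel_of_pow_le S hm bot_le hn ?_
  intro M _ h
  have : Submodule.torsionBySet R M ((⊥ : Ideal R) : Set R) = ⊤ := by
    ext; simp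
  have h' : Mem S (Submodule.torsionBySet R M ((⊥ : Ideal R) : Set R)) := h
  rw [this] at h'
  exact h'.inj (Submodule.topEquiv.symm : M ≃ₗ[R] _).toLinearMap
      (Submodule.topEquiv.symm : M ≃ₗ[R] _).injective

end serre

section artin
variable {R : Type} [CommRing R]

theorem artin_of_ker {M : Type} [AddCommGroup M] [Module R M] (x : R)
    (hx : ∀ m : M, ∃ n : ℕ, x ^ n • m = 0) (h : IsArtinian R (Submodule.torsionBy R M x)) :
    IsArtinian R M := by
  rw [← monotone_stabilizes_iff_artinian]
  intro A
  -- the leading terms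
  let K : ℕ → Submodule R M → Submodule R (Submodule.torsionBy R M x) := fun n B =>
    (B.map (LinearMap.lsmul R M (x ^ n))).comap (Submodule.subtype _)
  have hK : ∀ {n n' : ℕ} {B B' : Submodule R M}, n ≤ n' → B ≤ B' → K n' B ≤ K n B' := by
    rintro n n' B B' hn hB ⟨y, hy⟩ ⟨b, hb, hby⟩
    obtain ⟨d, rfl⟩ := Nat.exists_eq_add_of_le hn
    refine ⟨x ^ d • b, B'.smul_mem _ (hB hb), ?_⟩
    simp only [LinearMap.lsmul_apply] at hby ⊢
    rw [← hby, pow_add, mul_smul]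
  have key : ∀ B B' : Submodule R M, B ≤ B' → (∀ n, K n B' ≤ K n B) → B' ≤ B := by
    intro B B' hB hle b hb
    obtain ⟨n, hn⟩ := hx b
    induction n generalizing b with
    | zero => simp at hn; simp [hn]
    | succ n ih =>
      have h1 : x ^ n • b ∈ Submodule.torsionBy R M x := by
        rw [Submodule.mem_torsionBy_iff, ← mul_smul, ← pow_succ']; exact hn
      obtain ⟨a, ha, hab⟩ := hle n (x := ⟨x ^ n • b, h1⟩) ⟨b, hb, rfl⟩
      simp only [LinearMap.lsmul_apply, Submodule.subtype_apply] at hab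
      have := ih (b := b - a) (B'.sub_mem hb (hB ha)) (by rw [smul_sub, hab, sub_self])
      simpa using B.add_mem this ha
  have hA : ∀ {i j : ℕ}, i ≤ j → (OrderDual.ofDual (A j)) ≤ OrderDual.ofDual (A i) :=
    fun hij => A.monotone hij
  have mono : ∀ f : ℕ → Submodule R (Submodule.torsionBy R M x), (∀ i j, i ≤ j → f j ≤ f i) →
      ∃ n, ∀ m, n ≤ m → f n ≤ f m := by
    intro f hf
    obtain ⟨n, hn⟩ := IsArtinian.monotone_stabilizes
      (⟨fun i => OrderDual.toDual (f i), fun i j hij => hf i j hij⟩ :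
        ℕ →o (Submodule R (Submodule.torsionBy R M x))ᵒᵈ)
    exact ⟨n, fun m hm => le_of_eq (hn m hm)⟩
  obtain ⟨k0, hk0⟩ := mono (fun k => K k (OrderDual.ofDual (A k))) (fun i j hij => hK hij (hA hij))
  have hcol : ∀ n, ∃ k, ∀ j, k ≤ j →
      K n (OrderDual.ofDual (A k)) ≤ K n (OrderDual.ofDual (A j)) := fun n =>
    mono (fun k => K n (OrderDual.ofDual (A k))) (fun i j hij => hK le_rfl (hA hij))
  choose c hc using hcol
  let N := max k0 ((Finset.range k0).sup c)
  refine ⟨N, fun j hj => ?_⟩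
  refine le_antisymm (A.monotone hj) ?_
  refine key _ _ (hA hj) (fun n => ?_)
  by_cases hn : n < k0
  · have h1 : c n ≤ N := le_trans (Finset.le_sup (f := c) (Finset.mem_range.2 hn)) (le_max_right _ _)
    exact le_trans (hK le_rfl (hA h1)) (hc n j (h1.trans hj))
  · push Not at hn
    calc K n (OrderDual.ofDual (A N)) ≤ K k0 (OrderDual.ofDual (A k0)) := hK hn (hA (le_max_left _ _))
      _ ≤ _ := hk0 (max n j) (hn.trans (le_max_left _ _))
      _ ≤ _ := hK (le_max_left _ _) (hA (le_max_right _ _))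

theorem artin_of_finset (s : Finset R) : ∀ (M : Type) [AddCommGroup M] [Module R M]
    (_ : ∀ x ∈ s, ∀ m : M, ∃ n : ℕ, x ^ n • m = 0)
    (_ : IsArtinian R (Submodule.torsionBySet R M (s : Set R))), IsArtinian R M := by
  classical
  induction s using Finset.induction_on with
  | empty =>
    intro M _ _ _ h
    have : Submodule.torsionBySet R M ((∅ : Finset R) : Set R) = ⊤ := by
      ext; simp [Submodule.mem_torsionBySet_iff]
    rw [this] at h
    exact isArtinian_of_injective (Submodule.topEquiv.symm : M ≃ₗ[R] _).toLinearMap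
      (Submodule.topEquiv.symm : M ≃ₗ[R] _).injective
  | insert x s hx ih =>
    intro M _ _ hs h
    refine artin_of_ker x (hs x (by simp)) ?_
    refine ih _ (fun a ha m => ?_) ?_
    · obtain ⟨n, hn⟩ := hs a (by simp [ha]) m
      exact ⟨n, Subtype.ext hn⟩
    · refine isArtinian_of_injective ((Submodule.subtype _).restrict
        (p := Submodule.torsionBySet R (Submodule.torsionBy R M x) (s : Set R))
        (q := Submodule.torsionBySet R M ((insert x s : Finset R) : Set R)) ?_) ?_
      · intro y hy
        rw [Submodule.mem_torsionBySet_iff] at hy ⊢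
        rintro ⟨a, ha⟩
        rcases Finset.mem_insert.1 (Finset.mem_coe.1 ha) with rfl | ha
        · exact (Submodule.mem_torsionBy_iff _ _).1 y.2
        · exact congrArg Subtype.val (hy ⟨a, ha⟩)
      · exact restr_inj _ Subtype.val_injective _

theorem artin_of_torsion {I : Ideal R} (hI : I.FG) (M : Type) [AddCommGroup M] [Module R M]
    (ht : ∀ m : M, ∃ n : ℕ, ∀ x ∈ I ^ n, x • m = 0)
    (h : IsArtinian R (Submodule.torsionBySet R M (I : Set R))) : IsArtinian R M := by
  obtain ⟨s, rfl⟩ := hI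
  refine artin_of_finset s M (fun x hx m => ?_) ?_
  · obtain ⟨n, hn⟩ := ht m
    exact ⟨n, hn _ (Ideal.pow_mem_pow (Submodule.subset_span hx) n)⟩
  · have e : Submodule.torsionBySet R M (s : Set R) =
      Submodule.torsionBySet R M ((Submodule.span R (s : Set R) : Ideal R) : Set R) :=
        (Submodule.torsionBySet_eq_torsionBySet_span _)
    rw [e]; exact h

/-- Dual Artin-Rees. -/
theorem dual_artin_rees {I : Ideal R} (hI : I.FG) (M : Type) [AddCommGroup M] [Module R M]
    [IsArtinian R M] (A : Submodule R M) :
    ∃ n : ℕ, ∀ v : M, (∀ x ∈ I, x • v ∈ A) →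
      ∃ k ∈ Submodule.torsionBySet R M ((I ^ n : Ideal R) : Set R), v - k ∈ A := by
  let C : Submodule R M :=
    { carrier := {v | ∀ x ∈ I, x • v ∈ A}
      add_mem' := fun ha hb x hx => by rw [smul_add]; exact A.add_mem (ha x hx) (hb x hx)
      zero_mem' := fun x _ => by simp
      smul_mem' := fun c v hv x hx => by rw [smul_comm]; exact A.smul_mem c (hv x hx) }
  let T : Set (Submodule R M) := {K | K ≤ C ∧ C ≤ K ⊔ A}
  obtain ⟨K, hKT, hmin⟩ := set_has_minimal_iff_artinian.2 (inferInstance : IsArtinian R M) T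
    ⟨C, le_rfl, le_sup_left⟩
  have hrad : I ≤ (K.annihilator).radical := by
    intro x hx
    obtain ⟨n, hn⟩ := IsArtinian.monotone_stabilizes
      (⟨fun i => OrderDual.toDual (K.map (LinearMap.lsmul R M (x ^ i))), by
        intro i j hij
        obtain ⟨d, rfl⟩ := Nat.exists_eq_add_of_le hij
        rintro _ ⟨k, hk, rfl⟩
        exact ⟨x ^ d • k, K.smul_mem _ hk, by simp [pow_add, mul_smul, smul_comm (x ^ i) (x ^ d)]⟩⟩ :
        ℕ →o (Submodule R M)ᵒᵈ)
    have hn' : K.map (LinearMap.lsmul R M (x ^ n)) = K.map (LinearMap.lsmul R M (x ^ (n + 1))) :=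
      hn (n + 1) (Nat.le_succ n)
    refine ⟨n, ?_⟩
    let K' := K ⊓ Submodule.torsionBy R M (x ^ n)
    have hK' : K' ∈ T := by
      refine ⟨inf_le_left.trans hKT.1, fun v hv => ?_⟩
      obtain ⟨u, hu, a, ha, rfl⟩ := Submodule.mem_sup.1 (hKT.2 hv)
      have : x ^ n • u ∈ K.map (LinearMap.lsmul R M (x ^ (n + 1))) := by
        rw [← hn']; exact ⟨u, hu, rfl⟩
      obtain ⟨w, hw, hwu⟩ := this
      simp only [LinearMap.lsmul_apply] at hwu
      refine Submodule.mem_sup.2 ⟨u - x • w, ⟨K.sub_mem hu (K.smul_mem x hw), ?_⟩, a + x • w,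
        A.add_mem ha (hKT.1 hw x hx), by abel⟩
      simp only [SetLike.mem_coe]
      rw [Submodule.mem_torsionBy_iff, smul_sub, ← mul_smul, ← pow_succ, hwu, sub_self]
    have hEq : K ≤ K' := by
      by_contra hne
      exact hmin K' hK' (lt_of_le_of_ne inf_le_left (fun h => hne h.ge))
    rw [Submodule.mem_annihilator]
    intro k hk
    exact (Submodule.mem_torsionBy_iff _ _).1 (hEq hk).2
  obtain ⟨n, hn⟩ := Ideal.exists_pow_le_of_le_radical_of_fg hrad hI
  refine ⟨n, fun v hv => ?_⟩
  obtain ⟨k, hk, a, ha, rfl⟩ := Submodule.mem_sup.1 (hKT.2 (show v ∈ C from hv))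
  refine ⟨k, ?_, by simpa using ha⟩
  rw [Submodule.mem_torsionBySet_iff]
  rintro ⟨y, hy⟩
  exact Submodule.mem_annihilator.1 (hn hy) k hk

end artin

section construction
variable {R : Type} [CommRing R]

/-- The Serre class of noetherian modules. -/
def noeth (R : Type) [CommRing R] : SerreClass R where
  mem M := IsNoetherian R M
  mem_of_injective f hf h := by
    have := h
    exact isNoetherian_of_injective f hf
  mem_of_surjective f hf h := by
    have := h
    exact isNoetherian_of_surjective f (LinearMap.range_eq_top.2 hf)
  mem_of_extension f g hf hg hfg hA hB := by
    have := hA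
    have := hB
    exact isNoetherian_of_range_eq_ker f g hfg

theorem isNoetherian_torsion_quot {I : Ideal R} (hI : I.FG) {M N : Type} [AddCommGroup M]
    [Module R M] [AddCommGroup N] [Module R N] [IsArtinian R M]
    (f : M →ₗ[R] N) (hf : Function.Surjective f)
    (h : IsNoetherian R (Submodule.torsionBySet R M (I : Set R))) :
    IsNoetherian R (Submodule.torsionBySet R N (I : Set R)) := by
  obtain ⟨n, hn⟩ := dual_artin_rees hI M (LinearMap.ker f)
  have h1 : IsNoetherian R (Submodule.torsionBySet R M ((I ^ n : Ideal R) : Set R)) :=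
    Mem.pow (S := noeth R) hI h n
  let T := Submodule.torsionBySet R M ((I ^ n : Ideal R) : Set R)
  have h2 : IsNoetherian R (T.map f) := by
    refine isNoetherian_of_surjective (f.restrict (p := T) (q := T.map f)
      (fun x hx => Submodule.mem_map_of_mem hx)) ?_
    rw [LinearMap.range_eq_top]
    rintro ⟨_, x, hx, rfl⟩
    exact ⟨⟨x, hx⟩, rfl⟩
  have hle : Submodule.torsionBySet R N (I : Set R) ≤ T.map f := by
    intro y hy
    obtain ⟨v, rfl⟩ := hf y
    rw [Submodule.mem_torsionBySet_iff] at hy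
    obtain ⟨k, hk, hvk⟩ := hn v (fun x hx => by
      rw [LinearMap.mem_ker, map_smul]; exact hy ⟨x, hx⟩)
    refine ⟨k, hk, ?_⟩
    rw [LinearMap.mem_ker, map_sub, sub_eq_zero] at hvk
    exact hvk.symm
  exact isNoetherian_of_injective (Submodule.inclusion hle) (Submodule.inclusion_injective hle)

/-- Artinian modules `M` such that `0 :_M I` has finite length. -/
def cls (I : Ideal R) (hI : I.FG) : SerreClass R where
  mem M := IsArtinian R M ∧ IsNoetherian R (Submodule.torsionBySet R M (I : Set R))
  mem_of_injective {M N} f hf h := by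
    have := h.1
    have := h.2
    refine ⟨isArtinian_of_injective f hf, ?_⟩
    refine isNoetherian_of_injective (f.restrict (p := Submodule.torsionBySet R M (I : Set R))
      (q := Submodule.torsionBySet R N (I : Set R)) ?_) (restr_inj _ hf _)
    intro x hx
    rw [Submodule.mem_torsionBySet_iff] at hx ⊢
    intro a
    rw [← map_smul, hx a, map_zero]
  mem_of_surjective f hf h := by
    have := h.1
    exact ⟨isArtinian_of_surjective _ f hf, isNoetherian_torsion_quot hI f hf h.2⟩
  mem_of_extension {A M B} f g hf hg hfg hA hB := by
    have := hA.1
    have := hB.1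
    refine ⟨isArtinian_of_range_eq_ker f g hfg, ?_⟩
    have hg' : ∀ x ∈ Submodule.torsionBySet R M (I : Set R),
        g x ∈ Submodule.torsionBySet R B (I : Set R) := by
      intro x hx
      rw [Submodule.mem_torsionBySet_iff] at hx ⊢
      intro a
      rw [← map_smul, hx a, map_zero]
    refine Mem.ker_tgt (S := noeth R) (g.restrict hg') ?_ hB.2
    have hA2 := hA.2
    have h1 : IsNoetherian R ((Submodule.torsionBySet R A (I : Set R)).map f) := by
      refine isNoetherian_of_surjective (f.restrict (p := Submodule.torsionBySet R A (I : Set R))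
        (q := (Submodule.torsionBySet R A (I : Set R)).map f)
        (fun x hx => Submodule.mem_map_of_mem hx)) ?_
      rw [LinearMap.range_eq_top]
      rintro ⟨_, x, hx, rfl⟩
      exact ⟨⟨x, hx⟩, rfl⟩
    refine Mem.inj (S := noeth R) h1 ((Submodule.subtype _).restrict
      (p := LinearMap.ker (g.restrict hg'))
      (q := (Submodule.torsionBySet R A (I : Set R)).map f) ?_)
      (restr_inj _ Subtype.val_injective _)
    rintro ⟨x, hx⟩ hxk
    have hgx : g x = 0 := congrArg (fun z : Submodule.torsionBySet R B (I : Set R) => (z : B)) hxk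
    have : x ∈ LinearMap.range f := by rw [hfg]; exact hgx
    obtain ⟨a, rfl⟩ := this
    refine ⟨a, ?_, rfl⟩
    rw [SetLike.mem_coe, Submodule.mem_torsionBySet_iff]
    rw [Submodule.mem_torsionBySet_iff] at hx
    intro r
    apply hf
    rw [map_smul, hx r, map_zero]

theorem cls_mel (I : Ideal R) (hI : I.FG) : MelkerssonCondition R (cls I hI).mem I := by
  intro M ht h
  refine ⟨artin_of_torsion hI M ht h.1, ?_⟩
  have h2 : IsNoetherian R (Submodule.torsionBySet R
    (Submodule.torsionBySet R M (I : Set R)) (I : Set R)) := h.2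
  rw [Submodule.torsionBySet_torsionBySet_eq_top] at h2
  exact isNoetherian_of_injective (Submodule.topEquiv.symm :
    Submodule.torsionBySet R M (I : Set R) ≃ₗ[R] _).toLinearMap
      (Submodule.topEquiv.symm : Submodule.torsionBySet R M (I : Set R) ≃ₗ[R] _).injective

theorem exists_injective (R : Type) [CommRing R] (k : Type) [AddCommGroup k] [Module R k] :
    ∃ (J : ModuleCat.{0} R) (f : k →ₗ[R] J), Module.Injective R J ∧ Function.Injective f := by
  refine ⟨Injective.under (ModuleCat.of R k), (Injective.ι (ModuleCat.of R k)).hom, ?_, ?_⟩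
  · have : Injective (ModuleCat.of R (Injective.under (ModuleCat.of R k) : ModuleCat.{0} R)) :=
      Injective.injective_under (ModuleCat.of R k)
    exact Module.injective_module_of_injective_object R _
  · exact (ModuleCat.mono_iff_injective _).1 inferInstance

/-- A module `M` with an essential simple socle generated by `u`, in which
every `s ∉ p` has an `e` with `p e = 0` and `s e = u`. -/
theorem exists_hull [IsLocalRing R] (p : Ideal R) [p.IsPrime] :
    ∃ (M : Type) (_ : AddCommGroup M) (_ : Module R M) (u : M), u ≠ 0 ∧
      (∀ x ∈ IsLocalRing.maximalIdeal R, x • u = 0) ∧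
      (∀ e : M, e ≠ 0 → ∃ r : R, r • e = u) ∧
      (∀ s : R, s ∉ p → ∃ e : M, (∀ x ∈ p, x • e = 0) ∧ s • e = u) := by
  obtain ⟨J, f, hJ, hf⟩ := exists_injective R (R ⧸ IsLocalRing.maximalIdeal R)
  let w : J := f 1
  have hw : w ≠ 0 := by
    intro h
    have h1 : (1 : R ⧸ IsLocalRing.maximalIdeal R) = 0 := hf (h.trans (map_zero f).symm)
    have h2 : Ideal.Quotient.mk (IsLocalRing.maximalIdeal R) 1 = 0 := h1
    rw [Ideal.Quotient.eq_zero_iff_mem] at h2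
    exact (Ideal.ne_top_iff_one _).1 Ideal.IsPrime.ne_top' h2
  have hmw : ∀ x ∈ IsLocalRing.maximalIdeal R, x • w = 0 := by
    intro x hx
    have : x • (1 : R ⧸ IsLocalRing.maximalIdeal R) = 0 := by
      rw [Algebra.smul_def, mul_one]
      exact Ideal.Quotient.eq_zero_iff_mem.2 hx
    rw [← map_smul, this, map_zero]
  obtain ⟨N, -, hN⟩ := zorn_le_nonempty₀ {N : Submodule R J | w ∉ N} (by
    intro c hc hchain N hN
    refine ⟨sSup c, ?_, fun z hz => le_sSup hz⟩
    intro hmem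
    rw [Submodule.mem_sSup_of_directed ⟨N, hN⟩ hchain.directedOn] at hmem
    obtain ⟨y, hy, hwy⟩ := hmem
    exact hc hy hwy) ⊥ (by simpa using hw)
  refine ⟨J ⧸ N, inferInstance, inferInstance, N.mkQ w, ?_, ?_, ?_, ?_⟩
  · intro h
    exact hN.1 ((Submodule.Quotient.mk_eq_zero N).1 h)
  · intro x hx
    rw [← map_smul, hmw x hx, map_zero]
  · intro e he
    obtain ⟨e, rfl⟩ := N.mkQ_surjective e
    have heN : e ∉ N := fun h => he ((Submodule.Quotient.mk_eq_zero N).2 h)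
    have : w ∈ N ⊔ Submodule.span R {e} := by
      by_contra hcon
      exact heN (hN.2 (y := N ⊔ Submodule.span R {e}) hcon le_sup_left
        (Submodule.mem_sup_right (Submodule.mem_span_singleton_self e)))
    obtain ⟨n, hn, z, hz, hnz⟩ := Submodule.mem_sup.1 this
    obtain ⟨r, rfl⟩ := Submodule.mem_span_singleton.1 hz
    refine ⟨r, ?_⟩
    rw [← hnz, map_add, map_smul]
    have : N.mkQ n = 0 := (Submodule.Quotient.mk_eq_zero N).2 hn
    rw [this, zero_add]
  · intro s hs
    -- the map `R/p → R/p`, multiplication by `s`, is injective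
    let g : (R ⧸ p) →ₗ[R] (R ⧸ p) := LinearMap.lsmul R (R ⧸ p) s
    have hg : Function.Injective g := by
      rw [← LinearMap.ker_eq_bot, LinearMap.ker_eq_bot']
      intro y hy
      have h1 : Ideal.Quotient.mk p s * y = 0 := by
        have : s • y = 0 := hy
        rwa [Algebra.smul_def] at this
      rcases mul_eq_zero.1 h1 with h2 | h2
      · exact absurd (Ideal.Quotient.eq_zero_iff_mem.1 h2) hs
      · exact h2
    have hpm : p ≤ IsLocalRing.maximalIdeal R := IsLocalRing.le_maximalIdeal Ideal.IsPrime.ne_top'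
    let h : (R ⧸ p) →ₗ[R] J := Submodule.liftQ p (LinearMap.toSpanSingleton R J w) (by
      intro x hx
      rw [LinearMap.mem_ker, LinearMap.toSpanSingleton_apply]
      exact hmw x (hpm hx))
    obtain ⟨φ, hφ⟩ := hJ.out g hg h
    refine ⟨N.mkQ (φ (Submodule.Quotient.mk 1)), ?_, ?_⟩
    · intro x hx
      rw [← map_smul, ← map_smul, ← Submodule.Quotient.mk_smul]
      have : (Submodule.Quotient.mk (x • (1 : R)) : R ⧸ p) = 0 := by
        rw [Submodule.Quotient.mk_eq_zero]; simpa using hx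
      rw [this, map_zero, map_zero]
    · rw [← map_smul, ← map_smul]
      congr 1
      have := hφ (Submodule.Quotient.mk 1)
      refine this.trans ?_
      exact (Submodule.liftQ_apply p (LinearMap.toSpanSingleton R J w) 1).trans (by simp)

theorem cls_not_mel [IsNoetherianRing R] [IsLocalRing R] (p : Ideal R) [p.IsPrime] (hI : p.FG)
    (hp : p ≠ IsLocalRing.maximalIdeal R) :
    ¬ MelkerssonCondition R (cls p hI).mem (IsLocalRing.maximalIdeal R) := by
  intro hC
  obtain ⟨M, _, _, u, hu0, hu, hess, hdiv⟩ := exists_hull p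
  let m := IsLocalRing.maximalIdeal R
  have hfg : m.FG := IsNoetherian.noetherian m
  have htor : ∀ e : M, ∃ n : ℕ, ∀ x ∈ m ^ n, x • e = 0 := by
    intro e
    have hrad : m ≤ ((Submodule.span R {e}).annihilator).radical := by
      intro x hx
      obtain ⟨n, hn⟩ := monotone_stabilizes_iff_noetherian.2 (inferInstance : IsNoetherian R R)
        (⟨fun i => (Submodule.span R {x ^ i • e}).annihilator, by
          intro i j hij r hr
          rw [Submodule.mem_annihilator_span_singleton] at hr ⊢
          obtain ⟨d, rfl⟩ := Nat.exists_eq_add_of_le hij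
          rw [pow_add, mul_comm, mul_smul, smul_comm, hr, smul_zero]⟩ : ℕ →o Submodule R R)
      have hn' : (Submodule.span R {x ^ n • e}).annihilator =
        (Submodule.span R {x ^ (n + 1) • e}).annihilator := hn (n + 1) (Nat.le_succ n)
      refine ⟨n, ?_⟩
      rw [Submodule.mem_annihilator_span_singleton]
      by_contra hne
      obtain ⟨r, hr⟩ := hess _ hne
      have h1 : r ∈ (Submodule.span R {x ^ (n + 1) • e}).annihilator := by
        rw [Submodule.mem_annihilator_span_singleton, pow_succ', mul_smul, smul_comm, hr]
        exact hu x hx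
      rw [← hn', Submodule.mem_annihilator_span_singleton, hr] at h1
      exact hu0 h1
    obtain ⟨n, hn⟩ := Ideal.exists_pow_le_of_le_radical_of_fg hrad hfg
    exact ⟨n, fun x hx => (Submodule.mem_annihilator_span_singleton _ _).1 (hn hx)⟩
  have hsoc : IsSimpleModule R (Submodule.torsionBySet R M (m : Set R)) := by
    have huT : u ∈ Submodule.torsionBySet R M (m : Set R) := by
      rw [Submodule.mem_torsionBySet_iff]; exact fun a => hu a a.2
    rw [isSimpleModule_iff_toSpanSingleton_surjective]
    refine ⟨⟨⟨u, huT⟩, 0, fun h => hu0 (congrArg Subtype.val h)⟩, ?_⟩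
    have unit : ∀ e ∈ Submodule.torsionBySet R M (m : Set R), e ≠ 0 →
        ∃ r : R, IsUnit r ∧ r • e = u := by
      intro e he h0
      obtain ⟨r, hr⟩ := hess e h0
      refine ⟨r, ?_, hr⟩
      by_contra hcon
      rw [Submodule.mem_torsionBySet_iff] at he
      have := he ⟨r, (IsLocalRing.mem_maximalIdeal r).2 hcon⟩
      exact hu0 (hr.symm.trans this)
    rintro ⟨a, ha⟩ ha0 ⟨b, hb⟩
    by_cases hb0 : b = 0
    · exact ⟨0, Subtype.ext (by simp [hb0])⟩
    obtain ⟨r, -, hr⟩ := unit a ha (fun h => ha0 (Subtype.ext h))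
    obtain ⟨t, ⟨t, rfl⟩, ht⟩ := unit b hb hb0
    refine ⟨(↑t⁻¹ : R) * r, Subtype.ext ?_⟩
    change ((↑t⁻¹ : R) * r) • a = b
    rw [mul_smul, hr, ← ht, ← mul_smul, Units.inv_mul, one_smul]
  have hM := hC (ModuleCat.of R M) htor ⟨inferInstanceAs
    (IsArtinian R (Submodule.torsionBySet R M (m : Set R))), by
      have : IsNoetherian R (Submodule.torsionBySet R M (m : Set R)) := inferInstance
      exact isNoetherian_submodule' _⟩
  have hN : IsNoetherian R (Submodule.torsionBySet R M (p : Set R)) := hM.2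
  obtain ⟨x, hxm, hxp⟩ : ∃ x ∈ m, x ∉ p := by
    by_contra! hcon
    exact hp (le_antisymm (IsLocalRing.le_maximalIdeal Ideal.IsPrime.ne_top') hcon)
  obtain ⟨s, hs⟩ := isNoetherian_submodule.1 hN _ le_rfl
  -- a power of `x` kills everything
  have hk : ∃ n : ℕ, ∀ e ∈ s, x ^ n • e = 0 := by
    choose c hc using htor
    refine ⟨s.sup c, fun e he => ?_⟩
    obtain ⟨d, hd⟩ := Nat.exists_eq_add_of_le (Finset.le_sup (f := c) he)
    rw [hd, pow_add, mul_comm, mul_smul, hc e _ (Ideal.pow_mem_pow hxm _), smul_zero]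
  obtain ⟨n, hn⟩ := hk
  have hxn : x ^ n ∉ p := fun h => hxp (Ideal.IsPrime.mem_of_pow_mem inferInstance n h)
  obtain ⟨e, hpe, hse⟩ := hdiv _ hxn
  have he : e ∈ Submodule.torsionBySet R M (p : Set R) := by
    rw [Submodule.mem_torsionBySet_iff]; exact fun a => hpe a a.2
  have hle : Submodule.span R (s : Set M) ≤ Submodule.torsionBy R M (x ^ n) := by
    rw [Submodule.span_le]
    intro e he
    exact (Submodule.mem_torsionBy_iff _ _).2 (hn e he)
  rw [hs] at hle
  exact hu0 (hse.symm.trans ((Submodule.mem_torsionBy_iff _ _).1 (hle he)))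

end construction

end Mel

/-- Over a noetherian local ring with a unique minimal prime `q`:
(1) if `dim R = 2`, every Serre class `S` has `MP[S] = {q} ∪ W` for a specialization
closed `W`, or `MP[S] = {q} ∪ {p}` for a height-one prime `p`;
(2) conversely, if `MP[S]` always has one of these two forms, then `dim R ≤ 2`. -/
theorem stmt_19 {R : Type} [CommRing R] [IsNoetherianRing R] [IsLocalRing R]
    (q : PrimeSpectrum R) (hq : minimalPrimes R = {q.asIdeal}) :
    (ringKrullDim R = 2 →
      ∀ S : SerreClass R,
        (∃ W : Set (PrimeSpectrum R), SpecializationClosed R W ∧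
          MP R S.mem = {q} ∪ W) ∨
        (∃ p : PrimeSpectrum R, Order.height p = 1 ∧ MP R S.mem = {q} ∪ {p})) ∧
    ((∀ S : SerreClass R,
        (∃ W : Set (PrimeSpectrum R), SpecializationClosed R W ∧
          MP R S.mem = {q} ∪ W) ∨
        (∃ p : PrimeSpectrum R, Order.height p = 1 ∧ MP R S.mem = {q} ∪ {p})) →
      ringKrullDim R ≤ 2) := by
  classical
  have hqle : ∀ p : PrimeSpectrum R, q ≤ p := by
    intro p
    obtain ⟨r, hr, hrp⟩ := Ideal.exists_minimalPrimes_le (I := (⊥ : Ideal R)) (J := p.asIdeal) bot_le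
    have : r ∈ minimalPrimes R := hr
    rw [hq, Set.mem_singleton_iff] at this
    rw [this] at hrp
    exact hrp
  let m : PrimeSpectrum R := IsLocalRing.closedPoint R
  have hlem : ∀ p : PrimeSpectrum R, p ≤ m := fun p =>
    IsLocalRing.le_maximalIdeal p.isPrime.ne_top
  have hfg : ∀ I : Ideal R, I.FG := fun I => IsNoetherian.noetherian I
  have hradical : ∀ I J : Ideal R, (∀ P : PrimeSpectrum R, I ≤ P.asIdeal → J ≤ P.asIdeal) →
      ∃ n : ℕ, J ^ n ≤ I := by
    intro I J h
    refine Ideal.exists_pow_le_of_le_radical_of_fg ?_ (hfg J)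
    rw [Ideal.radical_eq_sInf]
    refine le_sInf ?_
    rintro P ⟨hIP, hP⟩
    exact h ⟨P, hP⟩ hIP
  constructor
  · intro hdim S
    have hqS : q ∈ MP R S.mem := by
      obtain ⟨n, hn⟩ := hradical ⊥ q.asIdeal (fun P _ => hqle P)
      exact Mel.mel_nil S (hfg _) hn
    have hm2 : Order.height m ≤ 2 := by
      have h4 := Order.height_le_krullDim m
      have h5 : (Order.height m : WithBot ℕ∞) ≤ ((2 : ℕ∞) : WithBot ℕ∞) :=
        h4.trans (le_of_eq hdim)
      exact WithBot.coe_le_coe.1 h5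
    have hht : ∀ p : PrimeSpectrum R, p ≠ q → p ≠ m → Order.height p = 1 := by
      intro p hpq hpm
      have h1 := Order.height_add_one_le (lt_of_le_of_ne (hqle p) hpq.symm)
      have h2 := (Order.height_add_one_le (lt_of_le_of_ne (hlem p) hpm)).trans hm2
      refine le_antisymm ?_ (le_trans (by simp) h1)
      have h3 : Order.height p + 1 ≤ 1 + 1 := h2.trans (by norm_num)
      exact (ENat.add_le_add_iff_right (by simp)).1 h3
    have hno : ∀ a b : PrimeSpectrum R, a ≠ q → a < b → b = m := by
      intro a b haq hab
      by_contra hbm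
      have hbq : b ≠ q := fun h => absurd (hqle a) (not_le_of_gt (h ▸ hab))
      have ham : a ≠ m := fun h => absurd (hlem b) (not_le_of_gt (h ▸ hab))
      have h1 := Order.height_add_one_le hab
      rw [hht a haq ham, hht b hbq hbm] at h1
      exact absurd h1 (by decide)
    by_cases hmS : m ∈ MP R S.mem
    · left
      refine ⟨MP R S.mem \ {q}, ?_, ?_⟩
      · intro p hp p' hpp'
        have hle : p ≤ p' := hpp'
        rcases eq_or_lt_of_le hle with rfl | hlt
        · exact hp
        · refine ⟨hno p p' hp.2 hlt ▸ hmS, fun h => ?_⟩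
          rw [Set.mem_singleton_iff] at h
          exact absurd (hqle p) (not_le_of_gt (h ▸ hlt))
      · rw [Set.union_sdiff_self]
        exact (Set.union_eq_self_of_subset_left (Set.singleton_subset_iff.2 hqS)).symm
    · by_cases hne : ∃ p ∈ MP R S.mem, p ≠ q
      · right
        obtain ⟨p, hpS, hpq⟩ := hne
        refine ⟨p, hht p hpq (fun h => hmS (h ▸ hpS)), ?_⟩
        ext p'
        constructor
        · intro hp'S
          by_contra hcon
          simp only [Set.mem_union, Set.mem_singleton_iff, not_or] at hcon
          apply hmS
          obtain ⟨n, hn⟩ := hradical (p.asIdeal ⊔ p'.asIdeal) m.asIdeal (fun P hP => by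
            have h1 : p ≤ P := le_sup_left.trans hP
            have h2 : p' ≤ P := le_sup_right.trans hP
            have hPm : P = m := by
              rcases eq_or_lt_of_le h1 with rfl | hlt
              · exact hno p' p hcon.1 (lt_of_le_of_ne h2 hcon.2)
              · exact hno p P hpq hlt
            rw [hPm])
          exact Mel.mel_of_pow_le S (hfg _) (sup_le (hlem p) (hlem p')) hn
            (Mel.mel_sup S hpS hp'S)
        · rintro (h | h)
          · rw [Set.mem_singleton_iff] at h; rw [h]; exact hqS
          · rw [Set.mem_singleton_iff] at h; rw [h]; exact hpS
      · left
        push Not at hne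
        refine ⟨∅, fun p hp => absurd hp (Set.notMem_empty p), ?_⟩
        ext p'
        simp only [Set.union_empty, Set.mem_singleton_iff]
        exact ⟨hne p', fun h => h ▸ hqS⟩
  · intro H
    by_contra hdim
    have h3 : ((3 : ℕ) : WithBot ℕ∞) ≤ Order.krullDim (PrimeSpectrum R) := by
      by_contra hcon
      rw [not_le, Order.krullDim_lt_coe_iff] at hcon
      apply hdim
      refine iSup_le (fun l => ?_)
      exact_mod_cast Nat.lt_succ_iff.1 (hcon l)
    obtain ⟨l, hl⟩ := Order.le_krullDim_iff.1 h3
    let p := l ⟨2, by omega⟩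
    have hp2 : 2 ≤ Order.height p := by
      exact_mod_cast Order.index_le_height l ⟨2, by omega⟩
    have hpm : p < m := lt_of_lt_of_le (l.strictMono (show (⟨2, by omega⟩ : Fin (l.length + 1)) <
      ⟨3, by omega⟩ by simp)) (hlem _)
    have hpq : p ≠ q := by
      have : l ⟨0, by omega⟩ < p := l.strictMono (Fin.mk_lt_mk.2 (by norm_num))
      intro h
      exact absurd (hqle (l ⟨0, by omega⟩)) (not_le_of_gt (h ▸ this))
    have hpI : p.asIdeal ≠ IsLocalRing.maximalIdeal R := fun h =>
      hpm.ne (PrimeSpectrum.ext h)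
    let S := Mel.cls p.asIdeal (hfg _)
    have hpS : p ∈ MP R S.mem := Mel.cls_mel _ _
    have hmS : m ∉ MP R S.mem := Mel.cls_not_mel p.asIdeal (hfg _) hpI
    rcases H S with ⟨W, hW, hMP⟩ | ⟨p', hp', hMP⟩
    · rw [hMP] at hpS hmS
      rcases hpS with h | h
      · exact hpq h
      · exact hmS (Or.inr (hW p h m (hlem p)))
    · rw [hMP] at hpS
      rcases hpS with h | h
      · exact hpq h
      · rw [Set.mem_singleton_iff] at h
        rw [h, hp'] at hp2
        exact absurd hp2 (by decide)
end
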